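/- arXiv:1304.0103 — 2 statements merged into one kernel-verified Lean document; each statement's English description precedes it below -/
import Mathlib

section
/- Let E ⊆ ℝ^d and E' ⊆ ℝ^{d'} be totally disconnected self-similar sets, each satisfying the open set condition, and suppose E and E' are generated by IFSs consisting of exactly N contracting similarities all having the same ratio r ∈ (0,1). Then E and E' are Lipschitz equivalent. -/
open MeasureTheory Metric Set Pointwise

noncomputable section

/-- An iterated function system (IFS) of contracting similarities on `ℝ^d`. -/
structure IFS (d : ℕ) : Type 1 where
  ι : Type
  fin : Fintype ι
  f : ι → EuclideanSpace ℝ (Fin d) → EuclideanSpace ℝ (Fin d)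
  r : ι → ℝ
  r_pos : ∀ i, 0 < r i
  r_lt_one : ∀ i, r i < 1
  sim : ∀ i x y, dist (f i x) (f i y) = r i * dist x y

attribute [instance] IFS.fin

namespace IFS

variable {d : ℕ}

/-- `E` is the self-similar set (attractor) of `S`: the unique nonempty compact set
with `E = ⋃ i, S.f i '' E`. -/
def IsAttractor (S : IFS d) (E : Set (EuclideanSpace ℝ (Fin d))) : Prop :=
  E.Nonempty ∧ IsCompact E ∧ E = ⋃ i, S.f i '' E

open scoped Classical in
/-- The self-similar set generated by `S`. -/
def attractor (S : IFS d) : Set (EuclideanSpace ℝ (Fin d)) :=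
  if h : ∃ E, S.IsAttractor E then h.choose else ∅

/-- `O` is an open set witnessing the open set condition for `S`. -/
def OSCSet (S : IFS d) (O : Set (EuclideanSpace ℝ (Fin d))) : Prop :=
  O.Nonempty ∧ IsOpen O ∧ Bornology.IsBounded O ∧
    (∀ i, S.f i '' O ⊆ O) ∧ ∀ i j, i ≠ j → Disjoint (S.f i '' O) (S.f j '' O)

/-- The open set condition. -/
def OSC (S : IFS d) : Prop := ∃ O, S.OSCSet O

/-- The strong separation condition. -/
def SSC (S : IFS d) : Prop :=
  ∀ i j : S.ι, i ≠ j → Disjoint (S.f i '' S.attractor) (S.f j '' S.attractor)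

/-- `r` is the ratio root of `S`: the ratios are commensurable with common root `r`. -/
def IsRatioRoot (S : IFS d) (r : ℝ) : Prop :=
  0 < r ∧ r < 1 ∧
    ∃ lam : S.ι → ℕ, (∀ i, 0 < lam i) ∧ (∀ i, S.r i = r ^ lam i) ∧ Finset.univ.gcd lam = 1

/-- The Hausdorff dimension of the attractor of `S`, as a real number. -/
def hdim (S : IFS d) : ℝ := (dimH S.attractor).toReal

/-- Membership in the class TOEC: OSC, commensurable ratios, totally disconnected attractor. -/
def MemTOEC (S : IFS d) : Prop :=
  S.OSC ∧ (∃ r, S.IsRatioRoot r) ∧ IsTotallyDisconnected S.attractor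

/-- Membership in TOEC(p, r): measure root `p` and ratio root `r`. -/
def MemTOECpr (S : IFS d) (p r : ℝ) : Prop :=
  S.MemTOEC ∧ S.IsRatioRoot r ∧ p = r ^ S.hdim

/-- The natural measure of a set: normalized `s`-dimensional Hausdorff measure, `s = dimH E_S`. -/
def natMeasure (S : IFS d) (F : Set (EuclideanSpace ℝ (Fin d))) : ℝ :=
  (μH[S.hdim] F / μH[S.hdim] S.attractor).toReal

/-- `F` is an interior separated set of `E_S`. -/
def IsIntSep (S : IFS d) (F : Set (EuclideanSpace ℝ (Fin d))) : Prop :=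
  IsCompact F ∧ F ⊆ S.attractor ∧ IsCompact (S.attractor \ F) ∧ ∃ O, S.OSCSet O ∧ F ⊆ O

end IFS

/-- The subring `ℤ[p]` of `ℝ` generated by `ℤ` and `p`. -/
def Zring (p : ℝ) : Subring ℝ := Subring.closure {p}

/-- The underlying set of reals of an ideal of a subring of `ℝ`. -/
def idealSet {R : Subring ℝ} (I : Ideal R) : Set ℝ := (fun x : R => (x : ℝ)) '' (I : Set R)

/-- The ideal `I_S` of `ℤ[p]` generated by the natural measures of interior separated sets. -/
def IFS.idealOf {d : ℕ} (S : IFS d) (p : ℝ) : Ideal (Zring p) :=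
  Ideal.span {x : Zring p | ∃ F, S.IsIntSep F ∧ (x : ℝ) = S.natMeasure F}

/-- Two ideals of a subring `R` of `ℝ` lie in the same ideal class: `a·I = b·J`
for some nonzero `a, b ∈ R`. -/
def SameIdealClass {R : Subring ℝ} (I J : Ideal R) : Prop :=
  ∃ a b : R, a ≠ 0 ∧ b ≠ 0 ∧ (a : ℝ) • idealSet I = (b : ℝ) • idealSet J

/-- Lipschitz equivalence of subsets of (possibly different) metric spaces. -/
def LipEquiv {X Y : Type*} [MetricSpace X] [MetricSpace Y] (A : Set X) (B : Set Y) : Prop :=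
  ∃ (f : X → Y) (L : ℝ), 1 ≤ L ∧ Set.BijOn f A B ∧
    ∀ x ∈ A, ∀ y ∈ A, L⁻¹ * dist x y ≤ dist (f x) (f y) ∧ dist (f x) (f y) ≤ L * dist x y

/-- `X` is bi-Lipschitz coded by the symbolic space on `Q` letters with contraction ratio `ρ`. -/
def SymbolicallyCoded (X : Type*) [MetricSpace X] (Q : ℕ) (ρ : ℝ) : Prop :=
  ∃ g : X → ℕ → Fin Q, Function.Bijective g ∧ ∃ c C : ℝ, 0 < c ∧ 0 < C ∧
    ∀ x y n, (∀ k < n, g x k = g y k) →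
      dist x y ≤ C * ρ ^ n ∧ (g x n ≠ g y n → c * ρ ^ n ≤ dist x y)

theorem SymbolicallyCoded.exists_equiv {X Y : Type*} [MetricSpace X] [MetricSpace Y] {Q : ℕ}
    {ρ : ℝ} (hρ : 0 < ρ) (hX : SymbolicallyCoded X Q ρ) (hY : SymbolicallyCoded Y Q ρ) :
    ∃ (e : X ≃ Y) (L : ℝ), 1 ≤ L ∧
      ∀ x y, L⁻¹ * dist x y ≤ dist (e x) (e y) ∧ dist (e x) (e y) ≤ L * dist x y := by
  obtain ⟨g, hg, c, C, hc, hC, H⟩ := hX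
  obtain ⟨g', hg', c', C', hc', hC', H'⟩ := hY
  set G := Equiv.ofBijective g hg with hG
  set G' := Equiv.ofBijective g' hg' with hG'
  set L := max 1 (max (C / c') (C' / c)) with hL
  have hL1 : 1 ≤ L := le_max_left _ _
  have hL0 : 0 < L := by linarith
  have hLa : C / c' ≤ L := (le_max_left _ _).trans (le_max_right _ _)
  have hLb : C' / c ≤ L := (le_max_right _ _).trans (le_max_right _ _)
  rw [div_le_iff₀ hc'] at hLa
  rw [div_le_iff₀ hc] at hLb
  refine ⟨G.trans G'.symm, L, hL1, fun x y => ?_⟩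
  by_cases hxy : x = y
  · subst hxy; simp
  have hne : ∃ n, g x n ≠ g y n := by
    by_contra! h
    exact hxy (hg.1 (funext h))
  classical
  have hn := Nat.find_spec hne
  have hlt : ∀ k < Nat.find hne, g x k = g y k := fun k hk => by
    simpa using Nat.find_min hne hk
  set n := Nat.find hne
  have key : ∀ z, g' ((G.trans G'.symm) z) = g z := fun z => by
    exact G'.apply_symm_apply (g z)
  obtain ⟨h1, h2⟩ := H x y n hlt
  obtain ⟨h3, h4⟩ := H' ((G.trans G'.symm) x) ((G.trans G'.symm) y) n
    (fun k hk => by rw [key, key]; exact hlt k hk)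
  specialize h2 hn
  specialize h4 (by rw [key, key]; exact hn)
  have hp : 0 < ρ ^ n := by positivity
  constructor
  · rw [inv_mul_le_iff₀ hL0]
    calc dist x y ≤ C * ρ ^ n := h1
      _ ≤ (L * c') * ρ ^ n := by gcongr
      _ = L * (c' * ρ ^ n) := by ring
      _ ≤ _ := by gcongr
  · calc _ ≤ C' * ρ ^ n := h3
      _ ≤ (L * c) * ρ ^ n := by gcongr
      _ = L * (c * ρ ^ n) := by ring
      _ ≤ _ := by gcongr

/-- A compact space is symbolically coded as soon as it belongs to a class of sets each of which
splits into `Q` well separated smaller sets of the class. -/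
theorem symbolicallyCoded_of_splitting {X : Type*} [MetricSpace X] [CompactSpace X] {Q : ℕ}
    {ρ c C : ℝ} (hρ0 : 0 < ρ) (hρ1 : ρ < 1) (hc : 0 < c) (hC : 0 < C)
    (P : ℕ → Set X → Prop) (h_univ : P 0 univ)
    (h_closed : ∀ n A, P n A → IsClosed A) (h_nonempty : ∀ n A, P n A → A.Nonempty)
    (h_diam : ∀ n A, P n A → ∀ x ∈ A, ∀ y ∈ A, dist x y ≤ C * ρ ^ n)
    (h_split : ∀ n A, P n A → ∃ B : Fin Q → Set X, (∀ i, P (n + 1) (B i)) ∧ (⋃ i, B i) = A ∧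
      ∀ i j, i ≠ j → ∀ x ∈ B i, ∀ y ∈ B j, c * ρ ^ n ≤ dist x y) :
    SymbolicallyCoded X Q ρ := by
  have h_split' : ∀ n (A : {A // P n A}), ∃ B : Fin Q → {B // P (n + 1) B},
      (⋃ i, (B i : Set X)) = A ∧
      ∀ i j, i ≠ j → ∀ x ∈ (B i : Set X), ∀ y ∈ (B j : Set X), c * ρ ^ n ≤ dist x y := by
    rintro n ⟨A, hA⟩
    obtain ⟨B, hB, h1, h2⟩ := h_split n A hA
    exact ⟨fun i => ⟨B i, hB i⟩, h1, h2⟩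
  choose B hBU hBs using h_split'
  let st : (ℕ → Fin Q) → (n : ℕ) → {A // P n A} := fun ω n =>
    Nat.rec ⟨univ, h_univ⟩ (fun n A => B n A (ω n)) n
  have st_succ : ∀ ω n, st ω (n + 1) = B n (st ω n) (ω n) := fun _ _ => rfl
  have hsub : ∀ n (A : {A // P n A}) i, (B n A i : Set X) ⊆ A := fun n A i => by
    rw [← hBU n A]; exact subset_iUnion (fun i => (B n A i : Set X)) i
  have hidx : ∀ n (A : {A // P n A}) (x : (A : Set X)), ∃ i, (x : X) ∈ (B n A i : Set X) := by
    rintro n A ⟨x, hx⟩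
    have := hx
    rw [← hBU n A] at this
    simpa using this
  choose idx hidx using hidx
  have st_congr : ∀ ω ω' n, (∀ k < n, ω k = ω' k) → st ω n = st ω' n := by
    intro ω ω' n
    induction n with
    | zero => intro _; rfl
    | succ n ih =>
      intro h
      rw [st_succ, st_succ, ih fun k hk => h k (by omega), h n (by omega)]
  have hex : ∀ x : X, ∃ ω : ℕ → Fin Q, ∀ n, x ∈ (st ω n).1 := by
    intro x
    let pt : (n : ℕ) → {A : {A // P n A} // x ∈ (A : Set X)} := fun n =>
      Nat.rec ⟨⟨univ, h_univ⟩, mem_univ x⟩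
        (fun n A => ⟨B n A.1 (idx n A.1 ⟨x, A.2⟩), hidx n A.1 ⟨x, A.2⟩⟩) n
    refine ⟨fun n => idx n (pt n).1 ⟨x, (pt n).2⟩, fun n => ?_⟩
    have : st (fun n => idx n (pt n).1 ⟨x, (pt n).2⟩) n = (pt n).1 := by
      induction n with
      | zero => rfl
      | succ n ih => rw [st_succ, ih]
    rw [this]
    exact (pt n).2
  have huniq : ∀ (x : X) (ω ω' : ℕ → Fin Q), (∀ n, x ∈ (st ω n).1) →
      (∀ n, x ∈ (st ω' n).1) → ω = ω' := by
    intro x ω ω' h h'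
    funext n
    induction n using Nat.strong_induction_on with
    | _ n ih =>
      by_contra hne
      have h1 := h (n + 1)
      have h2 := h' (n + 1)
      rw [st_succ] at h1 h2
      rw [st_congr ω ω' n ih] at h1
      have := hBs n _ _ _ hne x h1 x h2
      rw [dist_self] at this
      have : 0 < c * ρ ^ n := by positivity
      linarith
  choose g hg using hex
  have hclose : ∀ x y n, (∀ k < n, g x k = g y k) →
      dist x y ≤ C * ρ ^ n ∧ (g x n ≠ g y n → c * ρ ^ n ≤ dist x y) := by
    intro x y n h
    have hst := st_congr _ _ n h
    refine ⟨h_diam n _ (st (g x) n).2 x (hg x n) y (hst ▸ hg y n), fun hne => ?_⟩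
    have h1 := hg x (n + 1)
    have h2 := hg y (n + 1)
    rw [st_succ] at h1 h2
    rw [hst] at h1
    exact hBs n _ _ _ hne x h1 y h2
  refine ⟨g, ⟨fun x y hxy => ?_, fun ω => ?_⟩, c, C, hc, hC, hclose⟩
  · have hle : ∀ n, dist x y ≤ C * ρ ^ n := fun n => (hclose x y n fun k _ => by rw [hxy]).1
    have hlim : Filter.Tendsto (fun n => C * ρ ^ n) Filter.atTop (nhds (C * 0)) :=
      (tendsto_pow_atTop_nhds_zero_of_lt_one hρ0.le hρ1).const_mul C
    have := ge_of_tendsto' hlim hle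
    rw [mul_zero] at this
    exact dist_le_zero.1 this
  · obtain ⟨x, hx⟩ := IsCompact.nonempty_iInter_of_sequence_nonempty_isCompact_isClosed
      (fun n => ((st ω n).1 : Set X)) (fun n => hsub n _ _) (fun n => h_nonempty n _ (st ω n).2)
      (h_closed 0 _ (st ω 0).2).isCompact (fun n => h_closed n _ (st ω n).2)
    exact ⟨x, huniq x _ _ (hg x) (fun n => mem_iInter.1 hx n)⟩

/-- A system of similarities of a common ratio `r`, indexed by `ι`, whose images cover `X`. -/
structure SimSystem (X ι : Type*) [MetricSpace X] where
  φ : ι → X → X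
  r : ℝ
  r_pos : 0 < r
  r_lt_one : r < 1
  sim : ∀ i x y, dist (φ i x) (φ i y) = r * dist x y
  cover : ∀ x, ∃ i y, φ i y = x

namespace SimSystem

variable {X ι : Type*} [MetricSpace X] (S : SimSystem X ι)

/-- The composition of the maps of the system along a word. -/
def word (S : SimSystem X ι) : List ι → X → X
  | [] => id
  | i :: w => S.φ i ∘ word S w

theorem word_append (u w : List ι) (x : X) : S.word (u ++ w) x = S.word u (S.word w x) := by
  induction u with
  | nil => rfl
  | cons i u ih => simp [word, ih]

theorem dist_word (w : List ι) (x y : X) :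
    dist (S.word w x) (S.word w y) = S.r ^ w.length * dist x y := by
  induction w with
  | nil => simp [word]
  | cons i w ih => simp [word, S.sim, ih, pow_succ']; ring

theorem word_injective (w : List ι) : Function.Injective (S.word w) := by
  intro x y h
  have := S.dist_word w x y
  rw [h, dist_self] at this
  have hp := pow_pos S.r_pos w.length
  exact dist_eq_zero.1 (by nlinarith [dist_nonneg (x := x) (y := y)])

theorem exists_word (n : ℕ) (x : X) : ∃ w : List ι, w.length = n ∧ ∃ y, S.word w y = x := by
  induction n generalizing x with
  | zero => exact ⟨[], rfl, x, rfl⟩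
  | succ n ih =>
    obtain ⟨i, y, rfl⟩ := S.cover x
    obtain ⟨w, hw, z, rfl⟩ := ih y
    exact ⟨i :: w, by simp [hw], z, rfl⟩

/-- At every scale, only boundedly many cells lie near a given point. -/
def FiniteOverlap : Prop :=
  ∀ C : ℝ, ∃ K : ℕ, ∀ n x,
    {w : List ι | w.length = n ∧ ∃ y, dist x (S.word w y) ≤ C * S.r ^ n}.ncard ≤ K

end SimSystem

/-- `y` is reachable from `x` by a chain in `A` with jumps at most `ε`. -/
def ChainIn {X : Type*} [MetricSpace X] (A : Set X) (ε : ℝ) : X → X → Prop :=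
  Relation.ReflTransGen fun x y => x ∈ A ∧ y ∈ A ∧ dist x y ≤ ε

section Chains

variable {X : Type*} [MetricSpace X]

theorem ChainIn.mono {A : Set X} {ε ε' : ℝ} (h : ε ≤ ε') {x y : X} (hc : ChainIn A ε x y) :
    ChainIn A ε' x y :=
  Relation.ReflTransGen.mono (fun _ _ h' => ⟨h'.1, h'.2.1, h'.2.2.trans h⟩) _ _ hc

theorem ChainIn.symm {A : Set X} {ε : ℝ} {x y : X} (hc : ChainIn A ε x y) : ChainIn A ε y x := by
  induction hc with
  | refl => exact Relation.ReflTransGen.refl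
  | tail _ h ih => exact Relation.ReflTransGen.head ⟨h.2.1, h.1, by rw [dist_comm]; exact h.2.2⟩ ih

theorem ChainIn.dist_le_of_union {A B : Set X} {ε₁ ε₂ η₁ η₂ : ℝ} (hε₂ : 0 ≤ ε₂) (hη₂ : 0 ≤ η₂)
    (hη₁ : 0 ≤ η₁)
    (hε : 2 * ε₂ + η₂ ≤ ε₁) (hA : ∀ x y, ChainIn A ε₂ x y → dist x y ≤ η₂)
    (hB : ∀ x y, ChainIn B ε₁ x y → dist x y ≤ η₁) {x y : X} (h : ChainIn (A ∪ B) ε₂ x y) :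
    dist x y ≤ η₁ + 2 * (η₂ + ε₂) := by
  have key : ChainIn A ε₂ x y ∨ ∃ b b', b ∈ B ∧ b' ∈ B ∧ dist x b ≤ η₂ + ε₂ ∧ ChainIn B ε₁ b b' ∧
      (y = b' ∨ ∃ a, dist b' a ≤ ε₂ ∧ ChainIn A ε₂ a y) := by
    induction h with
    | refl => exact Or.inl Relation.ReflTransGen.refl
    | @tail y z _ hyz ih =>
      obtain ⟨hy, hz, hd⟩ := hyz
      rcases ih with ih | ⟨b, b', hb, hb', hxb, hbb', ih⟩
      · by_cases hzB : z ∈ B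
        · refine Or.inr ⟨z, z, hzB, hzB, ?_, Relation.ReflTransGen.refl, Or.inl rfl⟩
          linarith [dist_triangle x y z, hA _ _ ih]
        · have hzA : z ∈ A := hz.resolve_right hzB
          by_cases hyA : y ∈ A
          · exact Or.inl (ih.tail ⟨hyA, hzA, hd⟩)
          · have hyB : y ∈ B := hy.resolve_left hyA
            refine Or.inr ⟨y, y, hyB, hyB, ?_, Relation.ReflTransGen.refl,
              Or.inr ⟨z, hd, Relation.ReflTransGen.refl⟩⟩
            linarith [hA _ _ ih]
      · by_cases hzB : z ∈ B
        · refine Or.inr ⟨b, z, hb, hzB, hxb, hbb'.tail ⟨hb', hzB, ?_⟩, Or.inl rfl⟩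
          rcases ih with rfl | ⟨a, ha, hay⟩
          · linarith
          · linarith [dist_triangle b' a z, dist_triangle a y z, hA _ _ hay]
        · have hzA : z ∈ A := hz.resolve_right hzB
          rcases ih with rfl | ⟨a, ha, hay⟩
          · exact Or.inr ⟨b, y, hb, hb', hxb, hbb', Or.inr ⟨z, hd, Relation.ReflTransGen.refl⟩⟩
          · by_cases hyA : y ∈ A
            · exact Or.inr ⟨b, b', hb, hb', hxb, hbb', Or.inr ⟨a, ha, hay.tail ⟨hyA, hzA, hd⟩⟩⟩
            · have hyB : y ∈ B := hy.resolve_left hyA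
              refine Or.inr ⟨b, y, hb, hyB, hxb, hbb'.tail ⟨hb', hyB, ?_⟩,
                Or.inr ⟨z, hd, Relation.ReflTransGen.refl⟩⟩
              linarith [dist_triangle b' a y, hA _ _ hay]
  rcases key with h | ⟨b, b', -, -, hxb, hbb', rfl | ⟨a, ha, hay⟩⟩
  · linarith [hA _ _ h]
  · linarith [dist_triangle x b y, hB _ _ hbb']
  · linarith [dist_triangle x b y, dist_triangle b b' y, dist_triangle b' a y, hB _ _ hbb',
      hA _ _ hay]

theorem exists_chain_dist_le [CompactSpace X] [TotallyDisconnectedSpace X] {η : ℝ} (hη : 0 < η) :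
    ∃ δ > 0, ∀ x y : X, ChainIn univ δ x y → dist x y ≤ η := by
  classical
  have hex : ∀ x : X, ∃ V : Set X, IsClopen V ∧ x ∈ V ∧ V ⊆ ball x (η / 2) := fun x =>
    compact_exists_isClopen_in_isOpen isOpen_ball (mem_ball_self (by positivity))
  choose V hV hxV hVb using hex
  obtain ⟨t, ht⟩ := isCompact_univ.elim_finite_subcover V (fun x => (hV x).isOpen)
    (fun x _ => mem_iUnion.2 ⟨x, hxV x⟩)
  have hsep : ∀ x : X, ∃ δ > 0, ∀ a ∈ V x, ∀ b, dist a b ≤ δ → b ∈ V x := by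
    intro x
    obtain ⟨δ, hδ, h⟩ := (hV x).isClosed.isCompact.exists_thickening_subset_open (hV x).isOpen
      subset_rfl
    exact ⟨δ / 2, by positivity, fun a ha b hab => h (mem_thickening_iff.2
      ⟨a, ha, by rw [dist_comm]; linarith⟩)⟩
  choose δ hδ hδV using hsep
  obtain ⟨ε, hε, hεt⟩ : ∃ ε > 0, ∀ z ∈ t, ε ≤ δ z := by
    clear ht
    induction t using Finset.induction_on with
    | empty => exact ⟨1, one_pos, by simp⟩
    | insert a s _ ih =>
      obtain ⟨ε, hε, h⟩ := ih
      refine ⟨min ε (δ a), lt_min hε (hδ a), fun z hz => ?_⟩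
      rcases Finset.mem_insert.1 hz with rfl | hz
      · exact min_le_right _ _
      · exact (min_le_left _ _).trans (h z hz)
  refine ⟨ε, hε, fun x y h => ?_⟩
  obtain ⟨z, hz, hxz⟩ : ∃ z ∈ t, x ∈ V z := by simpa using ht (mem_univ x)
  have hyz : y ∈ V z := by
    induction h with
    | refl => exact hxz
    | tail _ h ih => exact hδV z _ ih _ (h.2.2.trans (hεt z hz))
  have h1 := hVb z hxz
  have h2 := hVb z hyz
  rw [mem_ball] at h1 h2
  linarith [dist_triangle_right x y z]

end Chains

namespace SimSystem

variable {X ι : Type*} [MetricSpace X] (S : SimSystem X ι)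

theorem chainIn_range_word {δ : ℝ} (w : List ι) {x y : X}
    (h : ChainIn (range (S.word w)) (δ * S.r ^ w.length) (S.word w x) y) :
    ∃ y', S.word w y' = y ∧ ChainIn univ δ x y' := by
  induction h with
  | refl => exact ⟨x, rfl, Relation.ReflTransGen.refl⟩
  | tail _ h ih =>
    obtain ⟨y', rfl, hy'⟩ := ih
    obtain ⟨-, ⟨z', rfl⟩, hd⟩ := h
    rw [dist_word, mul_comm] at hd
    exact ⟨z', rfl, hy'.tail ⟨mem_univ _, mem_univ _,
      le_of_mul_le_mul_right hd (pow_pos S.r_pos _)⟩⟩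

theorem chainIn_empty {δ : ℝ} {x y : X} (h : ChainIn ∅ δ x y) : x = y := by
  induction h with
  | refl => rfl
  | tail _ h _ => exact absurd h.1 (notMem_empty _)

theorem chainIn_eq_or_mem {A : Set X} {δ : ℝ} {x y : X} (h : ChainIn A δ x y) :
    x = y ∨ x ∈ A := by
  induction h with
  | refl => exact Or.inl rfl
  | tail _ h ih =>
    rcases ih with rfl | ih
    · exact Or.inr h.1
    · exact Or.inr ih

variable [CompactSpace X] [TotallyDisconnectedSpace X]

theorem exists_chain_dist_le_iUnion_cells (k : ℕ) {η : ℝ} (hη : 0 < η) :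
    ∃ δ > 0, ∀ n (s : Finset (List ι)), s.card ≤ k → (∀ w ∈ s, w.length = n) →
      ∀ x y, ChainIn (⋃ w ∈ s, range (S.word w)) (δ * S.r ^ n) x y → dist x y ≤ η * S.r ^ n := by
  classical
  induction k generalizing η with
  | zero =>
    refine ⟨1, one_pos, fun n s hs _ x y h => ?_⟩
    have : s = ∅ := by simpa using hs
    subst this
    have hxy : x = y := chainIn_empty (by simpa using h)
    subst hxy
    have := S.r_pos
    rw [dist_self]
    positivity
  | succ k ih =>
    obtain ⟨δ₁, hδ₁, h₁⟩ := exists_chain_dist_le (X := X) (half_pos hη)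
    obtain ⟨δ₂, hδ₂, h₂⟩ := ih (η := min (δ₁ / 2) (η / 8)) (by positivity)
    have hr := S.r_pos
    refine ⟨min δ₂ (min (δ₁ / 4) (η / 8)), by positivity, fun n s hs hlen x y h => ?_⟩
    rcases s.eq_empty_or_nonempty with rfl | ⟨w, hw⟩
    · have hxy : x = y := chainIn_empty (by simpa using h)
      subst hxy
      rw [dist_self]
      positivity
    have hU : (⋃ w ∈ s, range (S.word w)) =
        (⋃ v ∈ s.erase w, range (S.word v)) ∪ range (S.word w) := by
      conv_lhs => rw [← Finset.insert_erase hw]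
      rw [Finset.set_biUnion_insert, union_comm]
    rw [hU] at h
    have hp : 0 < S.r ^ n := by positivity
    have ha : min δ₂ (min (δ₁ / 4) (η / 8)) ≤ δ₂ := min_le_left _ _
    have hb : min δ₂ (min (δ₁ / 4) (η / 8)) ≤ δ₁ / 4 :=
      (min_le_right _ _).trans (min_le_left _ _)
    have hc : min δ₂ (min (δ₁ / 4) (η / 8)) ≤ η / 8 :=
      (min_le_right _ _).trans (min_le_right _ _)
    have hd : min (δ₁ / 2) (η / 8) ≤ δ₁ / 2 := min_le_left _ _
    have he : min (δ₁ / 2) (η / 8) ≤ η / 8 := min_le_right _ _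
    have h0 : 0 < min δ₂ (min (δ₁ / 4) (η / 8)) := by positivity
    set ε := min δ₂ (min (δ₁ / 4) (η / 8))
    set θ := min (δ₁ / 2) (η / 8)
    have hθ : 0 ≤ θ := by positivity
    have := h.dist_le_of_union (ε₁ := δ₁ * S.r ^ n) (η₂ := θ * S.r ^ n) (η₁ := η / 2 * S.r ^ n)
      (by positivity) (by positivity) (by positivity) (by nlinarith) ?_ ?_
    · nlinarith
    · intro x y hxy
      refine h₂ n (s.erase w) ?_ (fun v hv => hlen v (Finset.mem_of_mem_erase hv)) x y
        (hxy.mono (by gcongr))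
      rw [Finset.card_erase_of_mem hw]
      omega
    · intro x y hxy
      rcases chainIn_eq_or_mem hxy with rfl | ⟨x', rfl⟩
      · rw [dist_self]
        positivity
      · rw [← hlen w hw] at hxy
        obtain ⟨y', rfl, hy'⟩ := S.chainIn_range_word w hxy
        rw [dist_word, hlen w hw, mul_comm]
        gcongr
        exact h₁ _ _ hy'

theorem exists_uniformly_disconnected [Finite ι] (hS : S.FiniteOverlap) :
    ∃ δ, 0 < δ ∧ δ ≤ 1 ∧ ∀ n (x y : X), ChainIn univ (δ * S.r ^ n) x y → dist x y ≤ S.r ^ n := by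
  obtain ⟨K, hK⟩ := hS 2
  obtain ⟨δ, hδ, h⟩ := S.exists_chain_dist_le_iUnion_cells K (η := 1) one_pos
  have hr := S.r_pos
  refine ⟨min δ 1, by positivity, min_le_right _ _, fun n x y hxy => ?_⟩
  have hp : 0 < S.r ^ n := by positivity
  have hfin : {w : List ι | w.length = n ∧ ∃ y, dist x (S.word w y) ≤ 2 * S.r ^ n}.Finite :=
    (List.finite_length_eq ι n).subset fun w hw => hw.1
  have hs := hK n x
  rw [ncard_eq_toFinset_card _ hfin] at hs
  have hmem : ∀ z, dist x z ≤ 2 * S.r ^ n → z ∈ ⋃ w ∈ hfin.toFinset, range (S.word w) := by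
    intro z hz
    obtain ⟨w, hw, y, rfl⟩ := S.exists_word n z
    simp only [mem_iUnion]
    exact ⟨w, hfin.mem_toFinset.2 ⟨hw, y, hz⟩, y, rfl⟩
  have hdist : ∀ z, ChainIn (⋃ w ∈ hfin.toFinset, range (S.word w)) (δ * S.r ^ n) x z →
      dist x z ≤ S.r ^ n := fun z hz => by
    simpa using h n _ hs (fun w hw => (hfin.mem_toFinset.1 hw).1) x z hz
  refine hdist y ?_
  induction hxy with
  | refl => exact Relation.ReflTransGen.refl
  | @tail y z _ hyz ih =>
    have h1 := hdist y ih
    have h2 : dist y z ≤ δ * S.r ^ n := hyz.2.2.trans (by gcongr; exact min_le_left _ _)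
    have h3 : dist y z ≤ 1 * S.r ^ n := hyz.2.2.trans (by gcongr; exact min_le_right _ _)
    exact ih.tail ⟨hmem y (by linarith), hmem z (by linarith [dist_triangle x y z]), h2⟩

end SimSystem


/-- `𝒢` is a finite partition of `A` into nonempty sets. -/
structure IsPart {X : Type*} (𝒢 : Finset (Set X)) (A : Set X) : Prop where
  disj : ∀ G ∈ 𝒢, ∀ H ∈ 𝒢, G ≠ H → Disjoint G H
  nonempty : ∀ G ∈ 𝒢, G.Nonempty
  sUnion : ⋃₀ (𝒢 : Set (Set X)) = A

namespace IsPart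

variable {X : Type*} {𝒢 ℋ : Finset (Set X)} {A B : Set X}

theorem subset (h : IsPart 𝒢 A) {G : Set X} (hG : G ∈ 𝒢) : G ⊆ A :=
  h.sUnion ▸ subset_sUnion_of_mem hG

theorem empty : IsPart (∅ : Finset (Set X)) ∅ := ⟨by simp, by simp, by simp⟩

theorem singleton (hA : A.Nonempty) : IsPart {A} A :=
  ⟨by simp, by simpa using hA, by simp⟩

theorem of_subset (h : IsPart 𝒢 A) (hs : ℋ ⊆ 𝒢) : IsPart ℋ (⋃₀ (ℋ : Set (Set X))) :=
  ⟨fun G hG H hH => h.disj G (hs hG) H (hs hH), fun G hG => h.nonempty G (hs hG), rfl⟩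

theorem disjoint_of_disjoint (h : IsPart 𝒢 A) (h' : IsPart ℋ B) (hAB : Disjoint A B) :
    Disjoint 𝒢 ℋ := by
  refine Finset.disjoint_left.2 fun G hG hG' => ?_
  obtain ⟨x, hx⟩ := h.nonempty G hG
  exact disjoint_left.1 hAB (h.subset hG hx) (h'.subset hG' hx)

theorem union [DecidableEq (Set X)] (h : IsPart 𝒢 A) (h' : IsPart ℋ B) (hAB : Disjoint A B) :
    IsPart (𝒢 ∪ ℋ) (A ∪ B) := by
  refine ⟨fun G hG H hH hne => ?_, fun G hG => ?_, ?_⟩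
  · rcases Finset.mem_union.1 hG with hG | hG <;> rcases Finset.mem_union.1 hH with hH | hH
    · exact h.disj G hG H hH hne
    · exact hAB.mono (h.subset hG) (h'.subset hH)
    · exact hAB.symm.mono (h'.subset hG) (h.subset hH)
    · exact h'.disj G hG H hH hne
  · rcases Finset.mem_union.1 hG with hG | hG
    · exact h.nonempty G hG
    · exact h'.nonempty G hG
  · rw [Finset.coe_union, sUnion_union, h.sUnion, h'.sUnion]

theorem card_union [DecidableEq (Set X)] (h : IsPart 𝒢 A) (h' : IsPart ℋ B)
    (hAB : Disjoint A B) : (𝒢 ∪ ℋ).card = 𝒢.card + ℋ.card :=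
  Finset.card_union_of_disjoint (h.disjoint_of_disjoint h' hAB)

theorem disjoint_sUnion_sdiff [DecidableEq (Set X)] (h : IsPart 𝒢 A) (hs : ℋ ⊆ 𝒢) :
    Disjoint (⋃₀ (ℋ : Set (Set X))) (⋃₀ ((𝒢 \ ℋ : Finset (Set X)) : Set (Set X))) := by
  refine disjoint_left.2 ?_
  rintro x ⟨G, hG, hx⟩ ⟨H, hH, hx'⟩
  rw [Finset.mem_coe, Finset.mem_sdiff] at hH
  refine disjoint_left.1 (h.disj G (hs hG) H hH.1 ?_) hx hx'
  rintro rfl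
  exact hH.2 hG

theorem biUnion [DecidableEq (Set X)] (h : IsPart 𝒢 A) {P : Set X → Finset (Set X)}
    (hP : ∀ G ∈ 𝒢, IsPart (P G) G) : IsPart (𝒢.biUnion P) A := by
  refine ⟨fun G hG H hH hne => ?_, fun G hG => ?_, ?_⟩
  · obtain ⟨G', hG', hG⟩ := Finset.mem_biUnion.1 hG
    obtain ⟨H', hH', hH⟩ := Finset.mem_biUnion.1 hH
    by_cases heq : G' = H'
    · subst heq
      exact (hP _ hG').disj G hG H hH hne
    · exact (h.disj _ hG' _ hH' heq).mono ((hP _ hG').subset hG) ((hP _ hH').subset hH)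
  · obtain ⟨G', hG', hG⟩ := Finset.mem_biUnion.1 hG
    exact (hP _ hG').nonempty G hG
  · refine Subset.antisymm ?_ ?_
    · rintro x ⟨G, hG, hx⟩
      obtain ⟨G', hG', hG⟩ := Finset.mem_biUnion.1 hG
      exact h.subset hG' ((hP _ hG').subset hG hx)
    · intro x hx
      rw [← h.sUnion] at hx
      obtain ⟨G, hG, hx⟩ := hx
      rw [← (hP _ hG).sUnion] at hx
      obtain ⟨H, hH, hx⟩ := hx
      exact ⟨H, Finset.mem_biUnion.2 ⟨G, hG, hH⟩, hx⟩

theorem card_biUnion [DecidableEq (Set X)] (h : IsPart 𝒢 A) {P : Set X → Finset (Set X)}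
    (hP : ∀ G ∈ 𝒢, IsPart (P G) G) : (𝒢.biUnion P).card = ∑ G ∈ 𝒢, (P G).card :=
  Finset.card_biUnion fun G hG H hH hne =>
    (hP G hG).disjoint_of_disjoint (hP H hH) (h.disj G hG H hH hne)

/-- A partition can be coarsened to `q` blocks of at most `p` pieces each. -/
theorem exists_coarsening (h : IsPart 𝒢 A) {q p : ℕ} (h1 : q ≤ 𝒢.card) (h2 : 𝒢.card ≤ q * p) :
    ∃ ℋ : Finset (Set X), IsPart ℋ A ∧ ℋ.card = q ∧
      ∀ H ∈ ℋ, ∃ 𝒦 ⊆ 𝒢, IsPart 𝒦 H ∧ 1 ≤ 𝒦.card ∧ 𝒦.card ≤ p := by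
  classical
  induction q generalizing 𝒢 A with
  | zero =>
    have h0 : 𝒢 = ∅ := by simpa using h2
    subst h0
    exact ⟨∅, h, rfl, by simp⟩
  | succ q ih =>
    have hp : 1 ≤ p := by
      rcases Nat.eq_zero_or_pos p with rfl | hp
      · simp at h2; subst h2; simp at h1
      · exact hp
    rw [Nat.succ_mul] at h2
    have hqp : q ≤ q * p := Nat.le_mul_of_pos_right q hp
    obtain ⟨𝒦, h𝒦, hcard⟩ := Finset.exists_subset_card_eq
      (s := 𝒢) (n := max 1 (𝒢.card - q * p)) (by omega)
    have hrest : (𝒢 \ 𝒦).card = 𝒢.card - max 1 (𝒢.card - q * p) := by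
      rw [Finset.card_sdiff_of_subset h𝒦, hcard]
    have hdisj := h.disjoint_sUnion_sdiff h𝒦
    obtain ⟨ℋ, hℋ, hc, H⟩ := ih (h.of_subset (Finset.sdiff_subset (s := 𝒢) (t := 𝒦)))
      (by omega) (by omega)
    have hp𝒦 := h.of_subset h𝒦
    have hne : (⋃₀ (𝒦 : Set (Set X))).Nonempty := by
      obtain ⟨K, hK⟩ := Finset.card_pos.1 (show 0 < 𝒦.card by omega)
      exact (h.nonempty K (h𝒦 hK)).mono (subset_sUnion_of_mem hK)
    refine ⟨{⋃₀ (𝒦 : Set (Set X))} ∪ ℋ, ?_, ?_, ?_⟩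
    · have := (singleton hne).union hℋ hdisj
      rwa [← sUnion_union, ← Finset.coe_union, Finset.union_sdiff_of_subset h𝒦, h.sUnion] at this
    · rw [(singleton hne).card_union hℋ hdisj, hc, Finset.card_singleton, add_comm]
    · intro K hK
      rcases Finset.mem_union.1 hK with hK | hK
      · rw [Finset.mem_singleton] at hK
        subst hK
        exact ⟨𝒦, h𝒦, hp𝒦, by omega, by omega⟩
      · obtain ⟨𝒦', h1, h2⟩ := H K hK
        exact ⟨𝒦', h1.trans Finset.sdiff_subset, h2⟩

end IsPart

theorem Finset.exists_sum_eq_of_card_mul_le {α : Type*} (s : Finset α) {lo hi Q : ℕ}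
    (hle : lo ≤ hi) (h1 : s.card * lo ≤ Q) (h2 : Q ≤ s.card * hi) :
    ∃ q : α → ℕ, (∀ a ∈ s, lo ≤ q a ∧ q a ≤ hi) ∧ ∑ a ∈ s, q a = Q := by
  classical
  induction s using Finset.induction_on generalizing Q with
  | empty => exact ⟨fun _ => 0, by simp, by simp at h2; simp [h2]⟩
  | insert a s ha ih =>
    rw [Finset.card_insert_of_notMem ha, Nat.succ_mul] at h1 h2
    have hm : s.card * lo ≤ s.card * hi := Nat.mul_le_mul_left _ hle
    obtain ⟨q, hq, hsum⟩ := ih (Q := Q - max lo (Q - s.card * hi)) (by omega) (by omega)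
    refine ⟨Function.update q a (max lo (Q - s.card * hi)), ?_, ?_⟩
    · intro b hb
      by_cases hba : b = a
      · subst hba
        simp only [Function.update_self]
        omega
      · rw [Function.update_of_ne hba]
        exact hq b ((Finset.mem_insert.1 hb).resolve_left hba)
    · rw [Finset.sum_insert ha, Function.update_self, Finset.sum_congr rfl (g := q), hsum]
      · omega
      · intro b hb
        rw [Function.update_of_ne]
        rintro rfl
        exact ha hb

theorem Finset.exists_subset_sum_eq_mul_pow {α : Type*} (s : Finset α) (f : α → ℕ) {h N M : ℕ}
    (hN : 0 < N) (hf : ∀ a ∈ s, ∃ e ≤ M, f a = h * N ^ e)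
    (hs : h * N ^ M ≤ ∑ a ∈ s, f a) : ∃ t ⊆ s, ∑ a ∈ t, f a = h * N ^ M := by
  classical
  induction s using Finset.strongInduction with
  | H s ih =>
    rcases hs.eq_or_lt with heq | hlt
    · exact ⟨s, subset_rfl, heq.symm⟩
    have hne : s.Nonempty := by
      rw [Finset.nonempty_iff_ne_empty]
      rintro rfl
      simp at hlt
    obtain ⟨a, ha, hmin⟩ := s.exists_min_image f hne
    have hdvd : ∀ k, f a ≤ h * N ^ k → f a ∣ h * N ^ k := by
      intro k hk
      obtain ⟨e, -, he⟩ := hf a ha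
      rw [he] at hk ⊢
      rcases le_total e k with hek | hke
      · exact mul_dvd_mul_left _ (pow_dvd_pow _ hek)
      · have := Nat.mul_le_mul_left h (Nat.pow_le_pow_right hN hke)
        rw [le_antisymm hk this]
    have hdvd_sum : f a ∣ ∑ b ∈ s, f b := Finset.dvd_sum fun b hb => by
      obtain ⟨e, -, he⟩ := hf b hb
      have := hmin b hb
      rw [he] at this ⊢
      exact hdvd e this
    have hfa : f a ≤ h * N ^ M := by
      obtain ⟨e, heM, he⟩ := hf a ha
      rw [he]
      exact Nat.mul_le_mul_left h (Nat.pow_le_pow_right hN heM)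
    have hle : h * N ^ M + f a ≤ ∑ b ∈ s, f b := by
      have h1 := Nat.le_of_dvd (by omega) (Nat.dvd_sub hdvd_sum (hdvd M hfa))
      omega
    rw [← Finset.add_sum_erase s f ha] at hle
    obtain ⟨t, ht, hsum⟩ := ih (s.erase a) (Finset.erase_ssubset ha)
      (fun b hb => hf b (Finset.mem_of_mem_erase hb)) (by omega)
    exact ⟨t, ht.trans (Finset.erase_subset _ _), hsum⟩

/-- A `SimSystem` of bounded overlap on a bounded space which is uniformly disconnected at scale
`δ`, with an integer `m` such that cells `m` generations down are small compared to `δ`. -/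
structure DiscSystem (X ι : Type*) [MetricSpace X] extends SimSystem X ι where
  δ : ℝ
  δ_pos : 0 < δ
  δ_le_one : δ ≤ 1
  chain_le : ∀ n (x y : X), ChainIn univ (δ * r ^ n) x y → dist x y ≤ r ^ n
  m : ℕ
  base : X
  cell_le : ∀ x y : X, r ^ m * dist x y ≤ δ
  overlap : toSimSystem.FiniteOverlap

namespace DiscSystem

variable {X ι : Type*} [MetricSpace X] (S : DiscSystem X ι)

/-- `A` is separated by more than `δ * r ^ n` from its complement. -/
def Sat (n : ℕ) (A : Set X) : Prop :=
  ∀ x ∈ A, ∀ y, dist x y ≤ S.δ * S.r ^ n → y ∈ A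

/-- The words of length `n + m` whose cell has its base point in `A`. -/
def cells (n : ℕ) (A : Set X) : Set (List ι) :=
  {w | w.length = n + S.m ∧ S.word w S.base ∈ A}

/-- The number of cells of generation `n + m` in `A`. -/
def cnt (n : ℕ) (A : Set X) : ℕ := (S.cells n A).ncard

/-- `A` is separated from its complement at level `n`, and each of its images under a word of the
system is so too, and avoids all other cells of the same generation. -/
def IntSat (n : ℕ) (A : Set X) : Prop :=
  ∀ u : List ι, S.Sat (u.length + n) (S.word u '' A) ∧
    ∀ u' : List ι, u'.length = u.length → u' ≠ u → Disjoint (range (S.word u')) (S.word u '' A)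

/-- The component at scale `δ * r ^ n` of a point. -/
def node (n : ℕ) (x : X) : Set X := {y | ChainIn univ (S.δ * S.r ^ n) x y}

variable {S} {n n' : ℕ} {A B : Set X}

theorem Sat.mono (h : S.Sat n A) (hn : n ≤ n') : S.Sat n' A := fun x hx y hy =>
  h x hx y (hy.trans (mul_le_mul_of_nonneg_left
    (pow_le_pow_of_le_one S.r_pos.le S.r_lt_one.le hn) S.δ_pos.le))

theorem Sat.sUnion {𝒢 : Set (Set X)} (h : ∀ G ∈ 𝒢, S.Sat n G) : S.Sat n (⋃₀ 𝒢) := by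
  rintro x ⟨G, hG, hx⟩ y hy
  exact ⟨G, hG, h G hG x hx y hy⟩

theorem Sat.sdiff (hA : S.Sat n A) (hB : S.Sat n B) : S.Sat n (A \ B) := fun x hx y hy =>
  ⟨hA x hx.1 y hy, fun hyB => hx.2 (hB y hyB x (by rwa [dist_comm]))⟩

theorem Sat.isClosed (h : S.Sat n A) : IsClosed A := by
  refine isOpen_compl_iff.1 (Metric.isOpen_iff.2 fun y hy => ⟨S.δ * S.r ^ n, ?_, ?_⟩)
  · have := S.δ_pos
    have := S.r_pos
    positivity
  · intro x hx hxA
    exact hy (h x hxA y (mem_ball.1 hx).le)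

theorem Sat.lt_dist (hA : S.Sat n A) (hAB : Disjoint A B) {x y : X} (hx : x ∈ A) (hy : y ∈ B) :
    S.δ * S.r ^ n < dist x y := by
  by_contra! h
  exact disjoint_left.1 hAB (hA x hx y h) hy

theorem sat_univ : S.Sat n univ := fun _ _ _ _ => mem_univ _

theorem Sat.word_mem (h : S.Sat n A) {w : List ι} (hw : w.length = n + S.m) {x : X}
    (hx : S.word w x ∈ A) (y : X) : S.word w y ∈ A := by
  refine h _ hx _ ?_
  rw [S.dist_word, hw, pow_add, mul_assoc, mul_comm]
  exact mul_le_mul_of_nonneg_right (S.cell_le x y) (pow_pos S.r_pos n).le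

theorem sat_node (x : X) : S.Sat n (S.node n x) := fun _ hy _ hz =>
  Relation.ReflTransGen.tail hy ⟨mem_univ _, mem_univ _, hz⟩

theorem mem_node (x : X) : x ∈ S.node n x := Relation.ReflTransGen.refl

theorem Sat.node_subset (h : S.Sat n A) {x : X} (hx : x ∈ A) : S.node n x ⊆ A := by
  intro y hy
  induction hy with
  | refl => exact hx
  | tail _ h' ih => exact h _ ih _ h'.2.2

theorem dist_le_of_mem_node {x y z : X} (hy : y ∈ S.node n x) (hz : z ∈ S.node n x) :
    dist y z ≤ S.r ^ n :=
  S.chain_le n y z ((ChainIn.symm hy).trans hz)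

theorem cnt_empty : S.cnt n ∅ = 0 := by simp [cnt, cells]

section Count

variable [Fintype ι]

theorem finite_cells (n : ℕ) (A : Set X) : (S.cells n A).Finite :=
  (List.finite_length_eq ι (n + S.m)).subset fun _ hw => hw.1

theorem cnt_union (hAB : Disjoint A B) : S.cnt n (A ∪ B) = S.cnt n A + S.cnt n B := by
  rw [cnt, cnt, cnt, ← ncard_union_eq _ (finite_cells n A) (finite_cells n B)]
  · congr 1
    ext w
    simp only [cells, mem_ofPred_eq, mem_union]
    tauto
  · refine disjoint_left.2 fun w hw hw' => disjoint_left.1 hAB hw.2 hw'.2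

theorem cnt_mono (hAB : A ⊆ B) : S.cnt n A ≤ S.cnt n B :=
  ncard_le_ncard (fun _ hw => ⟨hw.1, hAB hw.2⟩) (finite_cells n B)

theorem cnt_sdiff (hAB : A ⊆ B) : S.cnt n A + S.cnt n (B \ A) = S.cnt n B := by
  rw [← cnt_union disjoint_sdiff_right, union_sdiff_cancel hAB]

theorem cnt_eq_sum {𝒢 : Finset (Set X)} (h : IsPart 𝒢 A) : S.cnt n A = ∑ G ∈ 𝒢, S.cnt n G := by
  classical
  induction 𝒢 using Finset.induction_on generalizing A with
  | empty => rw [← h.sUnion]; simp [cnt_empty]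
  | insert G 𝒢 hG ih =>
    have h' := h.of_subset (Finset.subset_insert G 𝒢)
    rw [Finset.sum_insert hG, ← ih h', ← cnt_union, ← h.sUnion, Finset.coe_insert,
      sUnion_insert]
    refine disjoint_left.2 fun x hx => ?_
    rintro ⟨H, hH, hx'⟩
    refine disjoint_left.1 (h.disj G (Finset.mem_insert_self _ _) H
      (Finset.mem_insert_of_mem hH) ?_) hx hx'
    rintro rfl
    exact hG hH

theorem Sat.cnt_succ (h : S.Sat n A) : S.cnt (n + 1) A = Fintype.card ι * S.cnt n A := by
  have : S.cells (n + 1) A = (fun p : ι × List ι => p.2 ++ [p.1]) '' (univ ×ˢ S.cells n A) := by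
    ext w
    constructor
    · rintro ⟨hw, hwA⟩
      obtain ⟨v, i, rfl⟩ : ∃ v i, w = v ++ [i] := by
        refine ⟨w.dropLast, w.getLast ?_, (List.dropLast_append_getLast _).symm⟩
        rintro rfl
        simp at hw
        omega
      have hv : v.length = n + S.m := by simp at hw; omega
      rw [S.word_append] at hwA
      exact ⟨(i, v), ⟨mem_univ _, hv, h.word_mem hv hwA _⟩, rfl⟩
    · rintro ⟨⟨i, v⟩, ⟨-, hv, hvA⟩, rfl⟩
      refine ⟨by simp [hv]; omega, ?_⟩
      simp only
      rw [S.word_append]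
      exact h.word_mem hv hvA _
  rw [cnt, this, ncard_image_of_injective, ncard_prod, ncard_univ, Nat.card_eq_fintype_card, cnt]
  rintro ⟨i, v⟩ ⟨j, w⟩ hvw
  simp only [List.append_singleton_inj] at hvw
  exact Prod.ext hvw.2 hvw.1

theorem Sat.cnt_add (h : S.Sat n A) (k : ℕ) :
    S.cnt (n + k) A = Fintype.card ι ^ k * S.cnt n A := by
  induction k with
  | zero => simp
  | succ k ih =>
    rw [← add_assoc, (h.mono (Nat.le_add_right n k)).cnt_succ, ih, pow_succ']
    ring

theorem Sat.cnt_pos (h : S.Sat n A) (hA : A.Nonempty) : 0 < S.cnt n A := by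
  obtain ⟨x, hx⟩ := hA
  obtain ⟨w, hw, y, rfl⟩ := S.exists_word (n + S.m) x
  exact (ncard_pos (finite_cells n A)).2 ⟨w, hw, h.word_mem hw hx _⟩

theorem exists_cnt_le (S : DiscSystem X ι) (D : ℝ) :
    ∃ K, ∀ n A, (∀ x ∈ A, ∀ y ∈ A, dist x y ≤ D * S.r ^ n) → S.cnt n A ≤ K := by
  obtain ⟨K, hK⟩ := S.overlap (D * (S.r ^ S.m)⁻¹)
  refine ⟨K, fun n A hA => ?_⟩
  rcases (S.cells n A).eq_empty_or_nonempty with h | ⟨w, hw, hwA⟩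
  · simp [cnt, h]
  · refine (ncard_le_ncard ?_ ?_).trans (hK (n + S.m) (S.word w S.base))
    · rintro v ⟨hv, hvA⟩
      refine ⟨hv, S.base, (hA _ hwA _ hvA).trans_eq ?_⟩
      have := (pow_pos S.r_pos S.m).ne'
      rw [pow_add]
      field_simp
    · exact (List.finite_length_eq ι (n + S.m)).subset fun _ h => h.1

end Count

theorem IntSat.sat (h : S.IntSat n A) : S.Sat n A := by
  simpa [SimSystem.word] using (h []).1

theorem IntSat.of_subset (h : S.IntSat n A) (hBA : B ⊆ A) (hB : S.Sat n' B) (hn : n ≤ n') :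
    S.IntSat n' B := by
  refine fun u => ⟨?_, fun u' h1 h2 => ((h u).2 u' h1 h2).mono_right (image_mono hBA)⟩
  rintro _ ⟨b, hb, rfl⟩ y hy
  obtain ⟨a, -, rfl⟩ := ((h u).1.mono (Nat.add_le_add_left hn _)) _ ⟨b, hBA hb, rfl⟩ y hy
  refine ⟨a, hB b hb a ?_, rfl⟩
  rw [S.dist_word, pow_add, mul_left_comm] at hy
  exact le_of_mul_le_mul_left hy (pow_pos S.r_pos _)

theorem IntSat.mono (h : S.IntSat n A) (hn : n ≤ n') : S.IntSat n' A :=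
  h.of_subset subset_rfl (h.sat.mono hn) hn

theorem IntSat.sUnion {𝒢 : Set (Set X)} (h : ∀ G ∈ 𝒢, S.IntSat n G) : S.IntSat n (⋃₀ 𝒢) := by
  refine fun u => ⟨?_, fun u' h1 h2 => ?_⟩
  · rintro _ ⟨x, ⟨G, hG, hx⟩, rfl⟩ y hy
    obtain ⟨z, hz, rfl⟩ := (h G hG u).1 _ ⟨x, hx, rfl⟩ y hy
    exact ⟨z, ⟨G, hG, hz⟩, rfl⟩
  · refine disjoint_left.2 ?_
    rintro _ hy ⟨x, ⟨G, hG, hx⟩, rfl⟩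
    exact disjoint_left.1 ((h G hG u).2 u' h1 h2) hy ⟨x, hx, rfl⟩

theorem IntSat.image_word (h : S.IntSat n A) (v : List ι) :
    S.IntSat (v.length + n) (S.word v '' A) := by
  intro u
  have himg : S.word u '' (S.word v '' A) = S.word (u ++ v) '' A := by
    rw [image_image]
    exact image_congr fun x _ => (S.word_append u v x).symm
  rw [himg]
  refine ⟨?_, fun u' h1 h2 => ?_⟩
  · rw [← add_assoc, ← List.length_append]
    exact (h _).1
  · refine disjoint_left.2 ?_
    rintro _ ⟨z, rfl⟩ hz
    obtain ⟨v', hv', z, rfl⟩ := S.exists_word v.length z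
    rw [← S.word_append] at hz
    refine disjoint_left.1 ((h (u ++ v)).2 (u' ++ v') (by simp [h1, hv']) ?_) ⟨z, rfl⟩ hz
    exact fun heq => h2 (List.append_inj_left heq h1)

theorem IntSat.cnt_image_word [Fintype ι] (h : S.IntSat n A) (u : List ι) :
    S.cnt (u.length + n) (S.word u '' A) = S.cnt n A := by
  have : S.cells (u.length + n) (S.word u '' A) = (u ++ ·) '' S.cells n A := by
    ext W
    constructor
    · rintro ⟨hW, hWA⟩
      obtain ⟨u', w, rfl, hu'⟩ : ∃ u' w, W = u' ++ w ∧ u'.length = u.length :=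
        ⟨W.take u.length, W.drop u.length, (List.take_append_drop _ _).symm, by
          rw [List.length_take]; omega⟩
      rw [S.word_append] at hWA
      have huu : u' = u := by
        by_contra hne
        exact disjoint_left.1 ((h u).2 u' hu' hne) ⟨_, rfl⟩ hWA
      subst huu
      refine ⟨w, ⟨by simp at hW; omega, ?_⟩, rfl⟩
      exact (S.word_injective u').mem_set_image.1 hWA
    · rintro ⟨w, ⟨hw, hwA⟩, rfl⟩
      refine ⟨by simp [hw]; omega, ?_⟩
      simp only [S.word_append]
      exact mem_image_of_mem _ hwA
  rw [cnt, this, ncard_image_of_injective _ (List.append_right_injective u), cnt]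

theorem exists_intSat [Fintype ι] (S : DiscSystem X ι) :
    ∃ n A, S.IntSat n A ∧ A.Nonempty := by
  let Nb : List ι → Set (List ι) := fun w =>
    {w' | w'.length = w.length ∧ ∃ x y, dist (S.word w x) (S.word w' y) ≤ 2 * S.r ^ w.length}
  have hfin : ∀ w, (Nb w).Finite := fun w =>
    (List.finite_length_eq ι w.length).subset fun _ h => h.1
  obtain ⟨K, hK⟩ := S.overlap (S.δ / S.r ^ S.m + 2)
  have hbd : ∀ w, (Nb w).ncard ≤ K := by
    intro w
    refine (ncard_le_ncard ?_ ?_).trans (hK w.length (S.word w S.base))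
    · rintro w' ⟨hw', x, y, hxy⟩
      refine ⟨hw', y, ?_⟩
      have h1 : dist S.base x ≤ S.δ / S.r ^ S.m := by
        rw [le_div_iff₀ (pow_pos S.r_pos _), mul_comm]
        exact S.cell_le _ _
      have h2 := mul_le_mul_of_nonneg_left h1 (pow_pos S.r_pos w.length).le
      have h3 := dist_triangle (S.word w S.base) (S.word w x) (S.word w' y)
      rw [S.dist_word] at h3
      linarith
    · exact (List.finite_length_eq ι w.length).subset fun _ h => h.1
  obtain ⟨w, hw⟩ : ∃ w, ∀ w', (Nb w').ncard ≤ (Nb w).ncard := by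
    have hb : BddAbove (range fun w => (Nb w).ncard) := ⟨K, by rintro _ ⟨w, rfl⟩; exact hbd w⟩
    obtain ⟨w, hw⟩ := Nat.sSup_mem (range_nonempty fun w => (Nb w).ncard) hb
    exact ⟨w, fun w' => (le_csSup hb ⟨w', rfl⟩).trans_eq hw.symm⟩
  have hNb : ∀ u, Nb (u ++ w) = (u ++ ·) '' Nb w := by
    intro u
    refine (eq_of_subset_of_ncard_le ?_ ?_ (hfin _)).symm
    · rintro _ ⟨w', ⟨hw', x, y, hxy⟩, rfl⟩
      refine ⟨by simp [hw'], x, y, ?_⟩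
      rw [S.word_append, S.word_append, S.dist_word, List.length_append, pow_add]
      have := pow_pos S.r_pos u.length
      nlinarith
    · rw [ncard_image_of_injective _ (List.append_right_injective u)]
      exact hw _
  have hrp : ∀ k, 0 < S.r ^ k := fun k => pow_pos S.r_pos k
  refine ⟨w.length, {y | ∃ x, ChainIn univ (S.δ * S.r ^ w.length) (S.word w x) y}, ?_,
    S.word w S.base, S.base, Relation.ReflTransGen.refl⟩
  intro u
  have key : ∀ x y z, ChainIn univ (S.δ * S.r ^ w.length) (S.word w x) y →
      dist (S.word u y) z ≤ S.δ * S.r ^ (u.length + w.length) → ∀ u' w' z', u'.length = u.length →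
      w'.length = w.length → S.word (u' ++ w') z' = z → u' = u := by
    rintro x y _ hxy hyz u' w' z' hu' hw' rfl
    have hmem : u' ++ w' ∈ Nb (u ++ w) := by
      refine ⟨by simp [hu', hw'], x, z', ?_⟩
      have h1 := mul_le_mul_of_nonneg_left (S.chain_le _ _ _ hxy) (hrp u.length).le
      have h2 := dist_triangle (S.word (u ++ w) x) (S.word u y) (S.word (u' ++ w') z')
      have h3 := mul_le_mul_of_nonneg_right S.δ_le_one (hrp (u.length + w.length)).le
      rw [S.word_append u w, S.dist_word] at h2
      rw [S.word_append u w, List.length_append]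
      rw [← pow_add] at h1
      linarith
    rw [hNb] at hmem
    obtain ⟨w'', -, hw''⟩ := hmem
    exact (List.append_inj_left hw'' hu'.symm).symm
  constructor
  · rintro _ ⟨y, ⟨x, hxy⟩, rfl⟩ z hz
    obtain ⟨W, hW, z', hz'⟩ := S.exists_word (u.length + w.length) z
    obtain ⟨u', w', rfl, hu'⟩ : ∃ u' w', W = u' ++ w' ∧ u'.length = u.length :=
      ⟨W.take u.length, W.drop u.length, (List.take_append_drop _ _).symm, by
        rw [List.length_take]; omega⟩
    have hw' : w'.length = w.length := by simp at hW; omega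
    obtain rfl := key x y z hxy hz u' w' z' hu' hw' hz'
    subst hz'
    rw [S.word_append] at hz ⊢
    refine ⟨_, ⟨x, Relation.ReflTransGen.tail hxy ⟨mem_univ _, mem_univ _, ?_⟩⟩, rfl⟩
    rw [S.dist_word, pow_add, mul_left_comm] at hz
    exact le_of_mul_le_mul_left hz (hrp _)
  · intro u' hu' hne
    refine disjoint_left.2 ?_
    rintro _ ⟨z, rfl⟩ ⟨y, ⟨x, hxy⟩, hyz⟩
    obtain ⟨w', hw', z', rfl⟩ := S.exists_word w.length z
    refine hne (key x y _ hxy ?_ u' w' z' hu' hw' (S.word_append _ _ _))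
    rw [hyz, dist_self]
    have := S.δ_pos
    have := hrp (u.length + w.length)
    positivity

end DiscSystem

namespace DiscSystem

variable {X ι : Type*} [MetricSpace X] [Fintype ι] {S : DiscSystem X ι} {n n' : ℕ} {A B : Set X}

/-- The possible cell counts of nonempty sets that are internally separated. -/
def counts (S : DiscSystem X ι) : Set ℕ :=
  {k | ∃ n A, S.IntSat n A ∧ A.Nonempty ∧ S.cnt n A = k}

theorem IntSat.exists_common_level (hA : S.IntSat n A) (hA0 : A.Nonempty) (k : ℕ) :
    ∃ A', S.IntSat (k + n) A' ∧ A'.Nonempty ∧ S.cnt (k + n) A' = S.cnt n A := by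
  obtain ⟨w, hw, -⟩ := S.exists_word k S.base
  subst hw
  exact ⟨_, hA.image_word w, hA0.image _, hA.cnt_image_word w⟩

theorem add_mem_counts [Nontrivial ι] {k l : ℕ} (hk : k ∈ S.counts) (hl : l ∈ S.counts) :
    k + l ∈ S.counts := by
  obtain ⟨n, A, hA, hA0, rfl⟩ := hk
  obtain ⟨n', B, hB, hB0, rfl⟩ := hl
  obtain ⟨A', hA', hA0', hcA⟩ := hA.exists_common_level hA0 n'
  obtain ⟨B', hB', hB0', hcB⟩ := hB.exists_common_level hB0 n
  obtain ⟨i, j, hij⟩ := exists_pair_ne ι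
  rw [add_comm] at hA' hcA
  have hA'' := hA'.image_word [i]
  have hB'' := hB'.image_word [j]
  have hdisj : Disjoint (S.word [i] '' A') (S.word [j] '' B') :=
    ((hB' [j]).2 [i] rfl (by simpa using hij)).mono_left (image_subset_range _ _)
  refine ⟨1 + (n + n'), ⋃₀ {S.word [i] '' A', S.word [j] '' B'}, IntSat.sUnion ?_, ?_, ?_⟩
  · rintro G (rfl | rfl)
    · exact hA''
    · exact hB''
  · rw [sUnion_pair]
    exact (hA0'.image _).inl
  · rw [sUnion_pair, cnt_union hdisj, ← hcA, ← hcB]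
    exact congrArg₂ _ (hA'.cnt_image_word [i]) (hB'.cnt_image_word [j])

theorem exists_filler [Nontrivial ι] (S : DiscSystem X ι) :
    ∃ h J a F, 0 < h ∧ 0 < a ∧ S.IntSat a F ∧ F.Nonempty ∧
      S.cnt a F = h * Fintype.card ι ^ J ∧ ∀ n A, S.IntSat n A → h ∣ S.cnt n A := by
  have hdvd : ∀ n A, S.IntSat n A → Nat.setGcd S.counts ∣ S.cnt n A := by
    intro n A hA
    rcases A.eq_empty_or_nonempty with rfl | hA0
    · simp [cnt_empty]
    · exact Nat.setGcd_dvd_of_mem ⟨n, A, hA, hA0, rfl⟩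
  have hpos : 0 < Nat.setGcd S.counts := by
    obtain ⟨n, A, hA, hA0⟩ := S.exists_intSat
    exact Nat.pos_of_dvd_of_pos (hdvd n A hA) (hA.sat.cnt_pos hA0)
  obtain ⟨k, hk⟩ := Nat.exists_mem_closure_of_ge S.counts
  have hN : 1 < Fintype.card ι := Fintype.one_lt_card
  have hle : k ≤ Nat.setGcd S.counts * Fintype.card ι ^ k :=
    (Nat.lt_pow_self hN).le.trans (Nat.le_mul_of_pos_left _ hpos)
  have hmem : Nat.setGcd S.counts * Fintype.card ι ^ k ∈ S.counts := by
    have hcl : ∀ l ∈ AddSubmonoid.closure S.counts, l = 0 ∨ l ∈ S.counts := by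
      intro l hl
      induction hl using AddSubmonoid.closure_induction with
      | mem x hx => exact Or.inr hx
      | zero => exact Or.inl rfl
      | add x y _ _ hx hy =>
        rcases hx with rfl | hx
        · simpa using hy
        · rcases hy with rfl | hy
          · exact Or.inr hx
          · exact Or.inr (add_mem_counts hx hy)
    refine (hcl _ (hk _ hle (dvd_mul_right _ _))).resolve_left ?_
    positivity
  obtain ⟨n, A, hA, hA0, hc⟩ := hmem
  refine ⟨_, k + 1, n + 1, A, hpos, Nat.succ_pos n, hA.mono (Nat.le_succ n), hA0, ?_, hdvd⟩
  rw [hA.sat.cnt_succ, hc, pow_succ]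
  ring

end DiscSystem

/-- A `DiscSystem` with a set `F` whose cell count is a power of the number of maps times the
greatest common divisor `h` of all possible cell counts. -/
structure FilledSystem (X ι : Type*) [MetricSpace X] [Fintype ι] extends DiscSystem X ι where
  h : ℕ
  J : ℕ
  a : ℕ
  F : Set X
  h_pos : 0 < h
  a_pos : 0 < a
  intSat_F : toDiscSystem.IntSat a F
  nonempty_F : F.Nonempty
  cnt_F : toDiscSystem.cnt a F = h * Fintype.card ι ^ J
  dvd_cnt : ∀ n A, toDiscSystem.IntSat n A → h ∣ toDiscSystem.cnt n A

namespace FilledSystem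

open DiscSystem

variable {X ι : Type*} [MetricSpace X] [Fintype ι] (S : FilledSystem X ι)
  {n n' : ℕ} {A B : Set X}

/-- The number of generations consumed by one filling step. -/
def b : ℕ := S.m + S.a

/-- The factor by which the cell count of what is left uncovered evolves in one filling step. -/
def θ : ℕ := Fintype.card ι ^ S.b - S.h * Fintype.card ι ^ S.J

/-- A packing of `v` by disjoint internally separated sets of level `n + M`, whose cell counts are
`h` times a power of the number of maps. -/
structure Packing (n M : ℕ) (v : Set X) (𝓕 : Finset (Set X)) : Prop where
  isPart : IsPart 𝓕 (⋃₀ (𝓕 : Set (Set X)))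
  subset : ∀ G ∈ 𝓕, G ⊆ v
  intSat : ∀ G ∈ 𝓕, S.IntSat (n + M) G
  cnt_eq : ∀ G ∈ 𝓕, ∃ e ≤ M, S.cnt (n + M) G = S.h * Fintype.card ι ^ e

variable {S}

theorem Packing.sUnion_subset {M : ℕ} {v : Set X} {𝓕 : Finset (Set X)} (h : S.Packing n M v 𝓕) :
    ⋃₀ (𝓕 : Set (Set X)) ⊆ v := Set.sUnion_subset h.subset

theorem exists_fill_step (hA : S.Sat n A) :
    ∃ 𝓕 : Finset (Set X), IsPart 𝓕 (⋃₀ (𝓕 : Set (Set X))) ∧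
      (∀ G ∈ 𝓕, G ⊆ A ∧ S.IntSat (n + S.b) G ∧
        S.cnt (n + S.b) G = S.h * Fintype.card ι ^ S.J) ∧ 𝓕.card = S.cnt n A := by
  classical
  have hinj : InjOn (fun w => S.word w '' S.F) (S.cells n A) := by
    intro w hw w' hw' heq
    by_contra hne
    obtain ⟨x, hx⟩ := S.nonempty_F
    refine disjoint_left.1 ((S.intSat_F w).2 w' (hw'.1.trans hw.1.symm) (Ne.symm hne))
      (mem_range_self x) ?_
    simp only at heq
    rw [heq]
    exact mem_image_of_mem _ hx
  refine ⟨(finite_cells (S := S.toDiscSystem) n A).toFinset.image fun w => S.word w '' S.F, ⟨?_, ?_, rfl⟩, ?_, ?_⟩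
  · intro G hG H hH hne
    simp only [Finset.mem_image, Finite.mem_toFinset] at hG hH
    obtain ⟨w, hw, rfl⟩ := hG
    obtain ⟨w', hw', rfl⟩ := hH
    have hww : w ≠ w' := by
      rintro rfl
      exact hne rfl
    exact ((S.intSat_F w').2 w (hw.1.trans hw'.1.symm) hww).mono_left (image_subset_range _ _)
  · intro G hG
    simp only [Finset.mem_image, Finite.mem_toFinset] at hG
    obtain ⟨w, hw, rfl⟩ := hG
    exact S.nonempty_F.image _
  · intro G hG
    simp only [Finset.mem_image, Finite.mem_toFinset] at hG
    obtain ⟨w, hw, rfl⟩ := hG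
    have hlen : n + S.b = w.length + S.a := by rw [hw.1, b, add_assoc]
    rw [hlen]
    refine ⟨?_, S.intSat_F.image_word w, (S.intSat_F.cnt_image_word w).trans S.cnt_F⟩
    rintro _ ⟨x, -, rfl⟩
    exact hA.word_mem hw.1 hw.2 x
  · rw [Finset.card_image_of_injOn (by simpa using hinj), cnt, ncard_eq_toFinset_card _ (finite_cells n A)]

theorem cnt_fill_step {𝓕 : Finset (Set X)} {M k : ℕ}
    (h𝓕 : IsPart 𝓕 (⋃₀ (𝓕 : Set (Set X)))) (h : ∀ G ∈ 𝓕, S.cnt M G = k) :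
    S.cnt M (⋃₀ (𝓕 : Set (Set X))) = 𝓕.card * k := by
  rw [cnt_eq_sum h𝓕, Finset.sum_congr rfl h, Finset.sum_const, smul_eq_mul]

theorem mul_pow_le (S : FilledSystem X ι) :
    S.h * Fintype.card ι ^ S.J ≤ Fintype.card ι ^ S.b := by
  obtain ⟨𝓕, h𝓕, hG, hc⟩ := exists_fill_step (S := S) (n := 0) (A := univ) sat_univ
  have h1 := cnt_fill_step h𝓕 fun G hG' => (hG G hG').2.2
  have h2 := cnt_mono (S := S.toDiscSystem) (n := 0 + S.b)
    (subset_univ (⋃₀ (𝓕 : Set (Set X))))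
  rw [(sat_univ (n := 0)).cnt_add, h1, hc, mul_comm] at h2
  exact Nat.le_of_mul_le_mul_right h2 ((sat_univ).cnt_pos ⟨S.base, mem_univ _⟩)

theorem θ_add (S : FilledSystem X ι) :
    S.θ + S.h * Fintype.card ι ^ S.J = Fintype.card ι ^ S.b :=
  Nat.sub_add_cancel S.mul_pow_le

theorem J_le [Nontrivial ι] (S : FilledSystem X ι) : S.J ≤ S.b :=
  (Nat.pow_le_pow_iff_right Fintype.one_lt_card).1
    ((Nat.le_mul_of_pos_left _ S.h_pos).trans S.mul_pow_le)

/-- Repeated filling leaves a proportion of cells that decays geometrically. -/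
theorem exists_packing [Nontrivial ι] (hA : S.Sat n A) (i : ℕ) :
    ∃ 𝓕 : Finset (Set X), S.Packing n (S.b * i) A 𝓕 ∧
      S.Sat (n + S.b * i) (A \ ⋃₀ (𝓕 : Set (Set X))) ∧
      S.cnt (n + S.b * i) (A \ ⋃₀ (𝓕 : Set (Set X))) = S.cnt n A * S.θ ^ i := by
  classical
  induction i with
  | zero =>
    refine ⟨∅, ⟨by simpa using IsPart.empty, by simp, by simp, by simp⟩, ?_, ?_⟩
    · simpa using hA
    · simp
  | succ i ih =>
    obtain ⟨𝓕, h𝓕, hsat, hcnt⟩ := ih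
    obtain ⟨𝓕', h𝓕', hG, hcard⟩ := exists_fill_step hsat
    have hlev : n + S.b * i + S.b = n + S.b * (i + 1) := by rw [mul_add, mul_one, add_assoc]
    rw [hlev] at hG
    have hsub' : ⋃₀ (𝓕' : Set (Set X)) ⊆ A \ ⋃₀ (𝓕 : Set (Set X)) :=
      Set.sUnion_subset fun G hG' => (hG G hG').1
    have hdisj : Disjoint (⋃₀ (𝓕 : Set (Set X))) (⋃₀ (𝓕' : Set (Set X))) :=
      disjoint_sdiff_right.mono_right hsub'
    have hdiff : A \ ⋃₀ ((𝓕 ∪ 𝓕' : Finset (Set X)) : Set (Set X)) =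
        (A \ ⋃₀ (𝓕 : Set (Set X))) \ ⋃₀ (𝓕' : Set (Set X)) := by
      rw [Finset.coe_union, sUnion_union, sdiff_sdiff]
    have hi : S.b * i ≤ S.b * (i + 1) := Nat.mul_le_mul_left _ (Nat.le_succ i)
    refine ⟨𝓕 ∪ 𝓕', ⟨?_, ?_, ?_, ?_⟩, ?_, ?_⟩
    · rw [Finset.coe_union, sUnion_union]
      exact h𝓕.isPart.union h𝓕' hdisj
    · intro G hG'
      rcases Finset.mem_union.1 hG' with hG' | hG'
      · exact h𝓕.subset G hG'
      · exact (hG G hG').1.trans sdiff_subset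
    · intro G hG'
      rcases Finset.mem_union.1 hG' with hG' | hG'
      · exact (h𝓕.intSat G hG').mono (by omega)
      · exact (hG G hG').2.1
    · intro G hG'
      rcases Finset.mem_union.1 hG' with hG' | hG'
      · obtain ⟨e, he, hc⟩ := h𝓕.cnt_eq G hG'
        refine ⟨e + S.b, by rw [mul_add, mul_one]; omega, ?_⟩
        rw [← hlev, (h𝓕.intSat G hG').sat.cnt_add, hc, pow_add]
        ring
      · exact ⟨S.J, S.J_le.trans (Nat.le_mul_of_pos_right _ (Nat.succ_pos i)), (hG G hG').2.2⟩
    · rw [hdiff]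
      exact (hsat.mono (by omega)).sdiff (Sat.sUnion fun G hG' => (hG G hG').2.1.sat)
    · rw [hdiff]
      have h1 := cnt_sdiff (S := S.toDiscSystem) (n := n + S.b * (i + 1)) hsub'
      rw [cnt_fill_step h𝓕' fun G hG' => (hG G hG').2.2, ← hlev, hsat.cnt_add, hlev, hcard, hcnt,
        ← S.θ_add] at h1
      rw [pow_succ]
      linarith

end FilledSystem

namespace FilledSystem

open DiscSystem

variable {X ι : Type*} [MetricSpace X] [Fintype ι] (S : FilledSystem X ι)
  {n M t : ℕ} {A v : Set X} {𝓕 : Finset (Set X)}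

/-- An internally separated set at scale `r ^ n` whose cell count is exactly `h * N ^ M`. -/
structure Good (M n : ℕ) (A : Set X) : Prop where
  nonempty : A.Nonempty
  dist_le : ∀ x ∈ A, ∀ y ∈ A, dist x y ≤ S.r ^ n
  intSat : S.IntSat (n + M) A
  cnt_eq : S.cnt (n + M) A = S.h * Fintype.card ι ^ M

variable {S}

theorem Packing.exists_part_good [Nontrivial ι] (hv : S.IntSat (n + M) v)
    (hd : ∀ x ∈ v, ∀ y ∈ v, dist x y ≤ S.r ^ n)
    (ht : S.cnt (n + M) v = S.h * Fintype.card ι ^ M * (t + 1)) (h𝓕 : S.Packing n M v 𝓕)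
    (hs : S.h * Fintype.card ι ^ M * t ≤ S.cnt (n + M) (⋃₀ (𝓕 : Set (Set X)))) :
    ∃ 𝒢, IsPart 𝒢 v ∧ (∀ G ∈ 𝒢, S.Good M n G) ∧ 𝒢.card = t + 1 := by
  classical
  have hN : 0 < Fintype.card ι := Fintype.card_pos
  have hunit : 0 < S.h * Fintype.card ι ^ M := mul_pos S.h_pos (pow_pos hN _)
  have hne : ∀ {B : Set X}, 0 < S.cnt (n + M) B → B.Nonempty := by
    intro B hB
    rw [nonempty_iff_ne_empty]
    rintro rfl
    simp [cnt_empty] at hB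
  induction t generalizing v 𝓕 with
  | zero =>
    have hvne := hne (B := v) (by rw [ht, zero_add, mul_one]; exact hunit)
    exact ⟨{v}, IsPart.singleton hvne, by simpa using ⟨hvne, hd, hv, by simpa using ht⟩, rfl⟩
  | succ t ih =>
    rw [cnt_eq_sum h𝓕.isPart] at hs
    obtain ⟨𝓣, h𝓣, hsum⟩ := 𝓕.exists_subset_sum_eq_mul_pow (S.cnt (n + M)) hN h𝓕.cnt_eq
      ((Nat.le_mul_of_pos_right _ (Nat.succ_pos t)).trans hs)
    have hp𝓣 := h𝓕.isPart.of_subset h𝓣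
    rw [← cnt_eq_sum hp𝓣] at hsum
    have hGv : ⋃₀ (𝓣 : Set (Set X)) ⊆ v := Set.sUnion_subset fun G hG => h𝓕.subset G (h𝓣 hG)
    have hGI : S.IntSat (n + M) (⋃₀ (𝓣 : Set (Set X))) :=
      IntSat.sUnion fun G hG => h𝓕.intSat G (h𝓣 hG)
    have hGne := hne (hsum ▸ hunit)
    have hdisj := h𝓕.isPart.disjoint_sUnion_sdiff h𝓣
    have hcnt := cnt_sdiff (S := S.toDiscSystem) (n := n + M) hGv
    have hsd := Finset.sum_sdiff (f := S.cnt (n + M)) h𝓣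
    rw [← cnt_eq_sum hp𝓣, ← cnt_eq_sum (h𝓕.isPart.of_subset
      (Finset.sdiff_subset (s := 𝓕) (t := 𝓣)))] at hsd
    obtain ⟨𝒢, h𝒢, hgood, hcard⟩ := ih (v := v \ ⋃₀ (𝓣 : Set (Set X))) (𝓕 := 𝓕 \ 𝓣)
      (hv.of_subset sdiff_subset (hv.sat.sdiff hGI.sat) le_rfl)
      (fun x hx y hy => hd x hx.1 y hy.1) (by linarith)
      ⟨h𝓕.isPart.of_subset Finset.sdiff_subset, fun G hG => subset_sdiff.2
        ⟨h𝓕.subset G (Finset.mem_sdiff.1 hG).1,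
          (hdisj.mono_right (subset_sUnion_of_mem hG)).symm⟩,
        fun G hG => h𝓕.intSat G (Finset.mem_sdiff.1 hG).1,
        fun G hG => h𝓕.cnt_eq G (Finset.mem_sdiff.1 hG).1⟩ (by linarith)
    refine ⟨{⋃₀ (𝓣 : Set (Set X))} ∪ 𝒢, ?_, ?_, ?_⟩
    · have := (IsPart.singleton hGne).union h𝒢 disjoint_sdiff_right
      rwa [union_sdiff_cancel hGv] at this
    · intro G hG
      rcases Finset.mem_union.1 hG with hG | hG
      · rw [Finset.mem_singleton] at hG
        subst hG
        exact ⟨hGne, fun x hx y hy => hd x (hGv hx) y (hGv hy), hGI, hsum⟩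
      · exact hgood G hG
    · rw [(IsPart.singleton hGne).card_union h𝒢 disjoint_sdiff_right, hcard,
        Finset.card_singleton, add_comm]

theorem exists_part_good_of_dist_le [Nontrivial ι] {i K : ℕ} (hv : S.IntSat n v)
    (hv0 : v.Nonempty) (hd : ∀ x ∈ v, ∀ y ∈ v, dist x y ≤ S.r ^ n) (hK : S.cnt n v ≤ K)
    (hi : K * S.θ ^ i ≤ Fintype.card ι ^ (S.b * i)) :
    ∃ 𝒢, IsPart 𝒢 v ∧ (∀ G ∈ 𝒢, S.Good (S.b * i) n G) ∧ S.h * 𝒢.card = S.cnt n v := by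
  obtain ⟨t, ht⟩ := S.dvd_cnt n v hv
  have hpos := hv.sat.cnt_pos hv0
  obtain ⟨t, rfl⟩ : ∃ s, t = s + 1 := Nat.exists_eq_succ_of_ne_zero (by
    rintro rfl
    simp [ht] at hpos)
  obtain ⟨𝓕, h𝓕, -, hcnt⟩ := exists_packing hv.sat i
  have h1 := cnt_sdiff (S := S.toDiscSystem) (n := n + S.b * i) h𝓕.sUnion_subset
  have h2 : S.cnt n v * S.θ ^ i ≤ S.h * Fintype.card ι ^ (S.b * i) :=
    ((Nat.mul_le_mul_right _ hK).trans hi).trans (Nat.le_mul_of_pos_left _ S.h_pos)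
  rw [hcnt, hv.sat.cnt_add] at h1
  obtain ⟨𝒢, h𝒢, hgood, hcard⟩ := h𝓕.exists_part_good (t := t) (hv.mono (Nat.le_add_right _ _)) hd
    (by rw [hv.sat.cnt_add, ht]; ring) (by rw [ht] at h1 h2; nlinarith)
  exact ⟨𝒢, h𝒢, hgood, by rw [hcard, ht]⟩

theorem exists_part_good [Nontrivial ι] {i K : ℕ}
    (hK : ∀ n A, (∀ x ∈ A, ∀ y ∈ A, dist x y ≤ S.r ^ n) → S.cnt n A ≤ K)
    (hi : K * S.θ ^ i ≤ Fintype.card ι ^ (S.b * i)) (hA : S.IntSat n A) :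
    ∃ 𝒢, IsPart 𝒢 A ∧ (∀ G ∈ 𝒢, S.Good (S.b * i) n G) ∧ S.h * 𝒢.card = S.cnt n A := by
  classical
  obtain ⟨k, hk⟩ : ∃ k, S.cnt n A = k := ⟨_, rfl⟩
  induction k using Nat.strong_induction_on generalizing A with
  | _ k ih =>
    rcases A.eq_empty_or_nonempty with rfl | ⟨x, hx⟩
    · exact ⟨∅, IsPart.empty, by simp, by simp [cnt_empty]⟩
    have hsub := hA.sat.node_subset hx
    have hd : ∀ y ∈ S.node n x, ∀ z ∈ S.node n x, dist y z ≤ S.r ^ n := fun y hy z hz =>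
      dist_le_of_mem_node hy hz
    have hnode := hA.of_subset hsub (sat_node x) le_rfl
    obtain ⟨𝒢, h𝒢, hgood, hcard⟩ := exists_part_good_of_dist_le hnode ⟨x, mem_node x⟩ hd
      (hK _ _ hd) hi
    have hpos := hnode.sat.cnt_pos ⟨x, mem_node x⟩
    have hcnt := cnt_sdiff (S := S.toDiscSystem) (n := n) hsub
    obtain ⟨ℋ, hℋ, hgood', hcard'⟩ := ih (S.cnt n (A \ S.node n x)) (by omega)
      (hA.of_subset sdiff_subset (hA.sat.sdiff (sat_node x)) le_rfl) rfl
    refine ⟨𝒢 ∪ ℋ, ?_, ?_, ?_⟩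
    · have := h𝒢.union hℋ disjoint_sdiff_right
      rwa [union_sdiff_cancel hsub] at this
    · intro G hG
      rcases Finset.mem_union.1 hG with hG | hG
      · exact hgood G hG
      · exact hgood' G hG
    · rw [h𝒢.card_union hℋ disjoint_sdiff_right, mul_add, hcard, hcard', hcnt]

theorem Good.exists_part [Nontrivial ι] {i K : ℕ}
    (hK : ∀ n A, (∀ x ∈ A, ∀ y ∈ A, dist x y ≤ S.r ^ n) → S.cnt n A ≤ K)
    (hi : K * S.θ ^ i ≤ Fintype.card ι ^ (S.b * i)) (hA : S.Good (S.b * i) n A) :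
    ∃ 𝒢, IsPart 𝒢 A ∧ (∀ G ∈ 𝒢, S.Good (S.b * i) (n + S.b * i) G) ∧
      𝒢.card = Fintype.card ι ^ (S.b * i) := by
  obtain ⟨𝒢, h𝒢, hgood, hcard⟩ := exists_part_good hK hi hA.intSat
  exact ⟨𝒢, h𝒢, hgood, Nat.eq_of_mul_eq_mul_left S.h_pos (hcard.trans hA.cnt_eq)⟩

theorem exists_part_node (hA : S.Sat n A) :
    ∃ 𝒢, IsPart 𝒢 A ∧ (∀ G ∈ 𝒢, S.Sat n G ∧ ∀ x ∈ G, ∀ y ∈ G, dist x y ≤ S.r ^ n) ∧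
      𝒢.card ≤ S.cnt n A := by
  classical
  obtain ⟨k, hk⟩ : ∃ k, S.cnt n A = k := ⟨_, rfl⟩
  induction k using Nat.strong_induction_on generalizing A with
  | _ k ih =>
    rcases A.eq_empty_or_nonempty with rfl | ⟨x, hx⟩
    · exact ⟨∅, IsPart.empty, by simp, by simp⟩
    have hsub := hA.node_subset hx
    have hpos := (sat_node (S := S.toDiscSystem) (n := n) x).cnt_pos ⟨x, mem_node x⟩
    have hcnt := cnt_sdiff (S := S.toDiscSystem) (n := n) hsub
    obtain ⟨ℋ, hℋ, hgood', hcard'⟩ := ih (S.cnt n (A \ S.node n x)) (by omega)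
      (hA.sdiff (sat_node x)) rfl
    have hs : IsPart {S.node n x} (S.node n x) := IsPart.singleton ⟨x, mem_node x⟩
    refine ⟨{S.node n x} ∪ ℋ, ?_, ?_, ?_⟩
    · have := hs.union hℋ disjoint_sdiff_right
      rwa [union_sdiff_cancel hsub] at this
    · intro G hG
      rcases Finset.mem_union.1 hG with hG | hG
      · rw [Finset.mem_singleton] at hG
        subst hG
        exact ⟨sat_node x, fun y hy z hz => dist_le_of_mem_node hy hz⟩
      · exact hgood' G hG
    · rw [hs.card_union hℋ disjoint_sdiff_right, Finset.card_singleton]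
      omega

end FilledSystem

theorem Nat.eventually_mul_pow_le_pow (C : ℕ) {a b : ℕ} (hab : a < b) :
    ∀ᶠ i in Filter.atTop, C * a ^ i ≤ b ^ i := by
  have hb : (0 : ℝ) < b := by exact_mod_cast (Nat.zero_le a).trans_lt hab
  have hlt : (a : ℝ) / b < 1 := (div_lt_one hb).2 (by exact_mod_cast hab)
  have hlim := (tendsto_pow_atTop_nhds_zero_of_lt_one (by positivity) hlt).const_mul (C : ℝ)
  rw [mul_zero] at hlim
  filter_upwards [hlim.eventually_lt_const one_pos] with i hi
  rw [div_pow, mul_div_assoc', div_lt_one (by positivity)] at hi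
  exact_mod_cast hi.le

namespace FilledSystem

open DiscSystem

variable {X ι : Type*} [MetricSpace X] [Fintype ι] {S : FilledSystem X ι} {n : ℕ} {A : Set X}

/-- `A` consists of at least one and at most `q` good sets of level `n`. -/
def GoodUnion (S : FilledSystem X ι) (q M n : ℕ) (A : Set X) : Prop :=
  ∃ 𝒢, IsPart 𝒢 A ∧ (∀ G ∈ 𝒢, S.Good M n G) ∧ 1 ≤ 𝒢.card ∧ 𝒢.card ≤ q

theorem GoodUnion.nonempty {q M : ℕ} (h : S.GoodUnion q M n A) : A.Nonempty := by
  obtain ⟨𝒢, h𝒢, -, h1, -⟩ := h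
  obtain ⟨G, hG⟩ := Finset.card_pos.1 h1
  exact (h𝒢.nonempty G hG).mono (h𝒢.subset hG)

theorem GoodUnion.sat {q M : ℕ} (h : S.GoodUnion q M n A) : S.Sat (n + M) A := by
  obtain ⟨𝒢, h𝒢, hgood, -⟩ := h
  rw [← h𝒢.sUnion]
  exact Sat.sUnion fun G hG => (hgood G hG).intSat.sat

theorem GoodUnion.exists_split [Nontrivial ι] {i K p : ℕ}
    (hK : ∀ n A, (∀ x ∈ A, ∀ y ∈ A, dist x y ≤ S.r ^ n) → S.cnt n A ≤ K)
    (hi : K * S.θ ^ i ≤ Fintype.card ι ^ (S.b * i)) (hp : p ≤ S.b * i)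
    (hA : S.GoodUnion (Fintype.card ι ^ p) (S.b * i) n A) :
    ∃ ℋ, IsPart ℋ A ∧ ℋ.card = Fintype.card ι ^ (S.b * i) ∧ ∀ H ∈ ℋ,
      S.GoodUnion (Fintype.card ι ^ p) (S.b * i) (n + S.b * i) H ∧
      ∀ x ∈ H, ∀ y ∈ H, dist x y ≤ S.r ^ n := by
  classical
  obtain ⟨𝒢, h𝒢, hgood, h1, hq⟩ := hA
  have hN : 0 < Fintype.card ι := Fintype.card_pos
  have hpow : Fintype.card ι ^ p * Fintype.card ι ^ (S.b * i - p) = Fintype.card ι ^ (S.b * i) := by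
    rw [← pow_add, Nat.add_sub_cancel' hp]
  obtain ⟨q, hq, hsum⟩ := 𝒢.exists_sum_eq_of_card_mul_le
    (lo := Fintype.card ι ^ (S.b * i - p)) (hi := Fintype.card ι ^ (S.b * i))
    (Q := Fintype.card ι ^ (S.b * i)) (Nat.pow_le_pow_right hN (Nat.sub_le _ _))
    ((Nat.mul_le_mul_right _ hq).trans_eq hpow) (Nat.le_mul_of_pos_left _ h1)
  have hex : ∀ G ∈ 𝒢, ∃ ℋ, IsPart ℋ G ∧ ℋ.card = q G ∧ ∀ H ∈ ℋ,
      S.GoodUnion (Fintype.card ι ^ p) (S.b * i) (n + S.b * i) H := by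
    intro G hG
    obtain ⟨𝒬, h𝒬, hgood', hcard⟩ := (hgood G hG).exists_part hK hi
    obtain ⟨ℋ, hℋ, hc, H⟩ := h𝒬.exists_coarsening (q := q G) (p := Fintype.card ι ^ p)
      (by rw [hcard]; exact (hq G hG).2)
      (by rw [hcard, ← hpow, mul_comm]; exact Nat.mul_le_mul_right _ (hq G hG).1)
    refine ⟨ℋ, hℋ, hc, fun G' hG' => ?_⟩
    obtain ⟨𝒦, h𝒦, hpart, hk⟩ := H G' hG'
    exact ⟨𝒦, hpart, fun L hL => hgood' L (h𝒦 hL), hk⟩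
  choose! ℋ hℋ hc H using hex
  refine ⟨𝒢.biUnion ℋ, h𝒢.biUnion hℋ, ?_, ?_⟩
  · rw [h𝒢.card_biUnion hℋ, Finset.sum_congr rfl hc, hsum]
  · intro G' hG'
    obtain ⟨G, hG, hG'⟩ := Finset.mem_biUnion.1 hG'
    exact ⟨H G hG G' hG', fun x hx y hy =>
      (hgood G hG).dist_le x ((hℋ G hG).subset hG' hx) y ((hℋ G hG).subset hG' hy)⟩

theorem coarsening_bounds {Q c k z u h a e q q' K : ℕ} (hh : 0 < h) (hu : u + z = Q * c)
    (hz : z ≤ k) (hk : 2 * k ≤ Q) (hc : 0 < c) (hcK : c ≤ K) (he : e ≤ z) (ha : h * a = q * u)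
    (hq : 2 * h ≤ q) (hq' : 2 * K * q ≤ q') : Q - e ≤ a ∧ a ≤ (Q - e) * q' := by
  have hQc : Q ≤ Q * c := Nat.le_mul_of_pos_right Q hc
  constructor
  · have h1 : h * (2 * u) ≤ h * a := by
      rw [ha, ← mul_assoc, mul_comm h 2]
      exact Nat.mul_le_mul_right u hq
    have h2 := Nat.le_of_mul_le_mul_left h1 hh
    omega
  · have h1 : a ≤ q * u := ha ▸ Nat.le_mul_of_pos_left a hh
    have h2 : q * u ≤ q * (Q * K) :=
      Nat.mul_le_mul_left q ((Nat.le.intro hu).trans (Nat.mul_le_mul_left Q hcK))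
    have h3 : Q * q' ≤ 2 * (Q - e) * q' := Nat.mul_le_mul_right q' (by omega)
    have h4 := Nat.mul_le_mul_left Q hq'
    nlinarith

theorem exists_split_of_sat [Nontrivial ι] {i K s p : ℕ}
    (hK : ∀ n A, (∀ x ∈ A, ∀ y ∈ A, dist x y ≤ S.r ^ n) → S.cnt n A ≤ K)
    (hi : 2 * K * S.θ ^ i ≤ Fintype.card ι ^ (S.b * i)) (hs : 2 * S.h ≤ Fintype.card ι ^ s)
    (hp : 2 * K * Fintype.card ι ^ s ≤ Fintype.card ι ^ p)
    (hA : S.Sat n A) (hA0 : A.Nonempty) (hAK : S.cnt n A ≤ K) :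
    ∃ ℋ, IsPart ℋ A ∧ ℋ.card = Fintype.card ι ^ (S.b * i) ∧ ∀ H ∈ ℋ,
      (S.Sat (n + S.b * i) H ∧ ∀ x ∈ H, ∀ y ∈ H, dist x y ≤ S.r ^ (n + S.b * i)) ∨
      S.GoodUnion (Fintype.card ι ^ p) (S.b * i) (n + S.b * i + s) H := by
  classical
  obtain ⟨𝓕, h𝓕, hsat, hcnt⟩ := exists_packing hA i
  have hU : S.IntSat (n + S.b * i) (⋃₀ (𝓕 : Set (Set X))) := IntSat.sUnion h𝓕.intSat
  obtain ⟨𝒢, h𝒢, hgood, hcard⟩ := exists_part_good (i := i) hK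
    (by rw [mul_assoc] at hi; omega)
    (hU.mono (Nat.le_add_right _ s))
  obtain ⟨𝒩, h𝒩, hnode, hcard'⟩ := exists_part_node hsat
  have h1 := cnt_sdiff (S := S.toDiscSystem) (n := n + S.b * i) h𝓕.sUnion_subset
  rw [hcnt, hA.cnt_add] at h1
  rw [hcnt] at hcard'
  rw [hU.sat.cnt_add] at hcard
  have hc := hA.cnt_pos hA0
  have hz : S.cnt n A * S.θ ^ i ≤ K * S.θ ^ i := Nat.mul_le_mul_right _ hAK
  have hi' : 2 * (K * S.θ ^ i) ≤ Fintype.card ι ^ (S.b * i) := by rwa [← mul_assoc]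
  obtain ⟨hle, hle'⟩ := coarsening_bounds (e := 𝒩.card) S.h_pos h1 hz hi' hc hAK hcard' hcard hs hp
  obtain ⟨ℋ, hℋ, hcℋ, H⟩ := h𝒢.exists_coarsening hle hle'
  refine ⟨ℋ ∪ 𝒩, ?_, ?_, ?_⟩
  · have := hℋ.union h𝒩 disjoint_sdiff_right
    rwa [union_sdiff_cancel h𝓕.sUnion_subset] at this
  · rw [hℋ.card_union h𝒩 disjoint_sdiff_right, hcℋ]
    omega
  · intro G hG
    rcases Finset.mem_union.1 hG with hG | hG
    · obtain ⟨𝒦, h𝒦, hpart, hk⟩ := H G hG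
      exact Or.inr ⟨𝒦, hpart, fun L hL => hgood L (h𝒦 hL), hk⟩
    · exact Or.inl (hnode G hG)

theorem exists_symbolicallyCoded [CompactSpace X] [Nontrivial ι] (S : FilledSystem X ι) :
    ∃ i₀, ∀ i ≥ i₀, SymbolicallyCoded X (Fintype.card ι ^ (S.b * i)) (S.r ^ (S.b * i)) := by
  have hN : 1 < Fintype.card ι := Fintype.one_lt_card
  have hb : 0 < S.b := Nat.add_pos_right _ S.a_pos
  obtain ⟨D, hD1, hD⟩ : ∃ D : ℝ, 1 ≤ D ∧ ∀ x y : X, dist x y ≤ D := by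
    refine ⟨max 1 (S.δ / S.r ^ S.m), le_max_left _ _, fun x y => le_max_of_le_right ?_⟩
    rw [le_div_iff₀ (pow_pos S.r_pos _), mul_comm]
    exact S.cell_le x y
  obtain ⟨K, hKD⟩ := S.exists_cnt_le D
  have hrp : ∀ n, 0 < S.r ^ n := fun n => pow_pos S.r_pos n
  have hK : ∀ n A, (∀ x ∈ A, ∀ y ∈ A, dist x y ≤ S.r ^ n) → S.cnt n A ≤ K := fun n A h =>
    hKD n A fun x hx y hy => (h x hx y hy).trans (le_mul_of_one_le_left (hrp n).le hD1)
  obtain ⟨s, hs⟩ : ∃ s, 2 * S.h ≤ Fintype.card ι ^ s := ⟨_, (Nat.lt_pow_self hN).le⟩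
  obtain ⟨p, hp⟩ : ∃ p, 2 * K * Fintype.card ι ^ s ≤ Fintype.card ι ^ p :=
    ⟨_, (Nat.lt_pow_self hN).le⟩
  have hθ : S.θ < Fintype.card ι ^ S.b := by
    have h1 := S.θ_add
    have h2 : 0 < S.h * Fintype.card ι ^ S.J := mul_pos S.h_pos (by positivity)
    omega
  refine Filter.eventually_atTop.1 ?_
  filter_upwards [Nat.eventually_mul_pow_le_pow (2 * K) hθ, Filter.eventually_ge_atTop p,
    Filter.eventually_gt_atTop 0] with i hi hip hi0
  rw [← pow_mul] at hi
  have hpM : p ≤ S.b * i := hip.trans (Nat.le_mul_of_pos_left i hb)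
  have hi' : K * S.θ ^ i ≤ Fintype.card ι ^ (S.b * i) := by
    rw [mul_assoc] at hi
    omega
  have hM : 0 < S.b * i := mul_pos hb hi0
  set M := S.b * i with hMdef
  have hone : ∀ n, 1 ≤ (S.r ^ n)⁻¹ := fun n =>
    (one_le_inv₀ (hrp n)).2 (pow_le_one₀ S.r_pos.le S.r_lt_one.le)
  have hlev : ∀ k, (S.r ^ M) ^ k = S.r ^ (M * k) := fun k => (pow_mul _ _ _).symm
  have hshift : ∀ k, (S.r ^ M)⁻¹ * S.r ^ (M * (k + 1)) = S.r ^ (M * k) := fun k => by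
    have := (hrp M).ne'
    rw [mul_add, mul_one, pow_add]
    field_simp
  refine symbolicallyCoded_of_splitting (c := S.δ * S.r ^ (2 * M + s)) (C := D * (S.r ^ M)⁻¹)
    (hrp M) (pow_lt_one₀ S.r_pos.le S.r_lt_one hM.ne') (mul_pos S.δ_pos (hrp _))
    (mul_pos (by linarith) (inv_pos.2 (hrp M)))
    (fun k A => (S.Sat (M * k) A ∧ A.Nonempty ∧ ∀ x ∈ A, ∀ y ∈ A, dist x y ≤ D * S.r ^ (M * k)) ∨
      (S.GoodUnion (Fintype.card ι ^ p) M (M * k + s) A ∧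
        ∀ x ∈ A, ∀ y ∈ A, dist x y ≤ D * (S.r ^ M)⁻¹ * S.r ^ (M * k))) ?_ ?_ ?_ ?_ ?_
  · exact Or.inl ⟨sat_univ, ⟨S.base, mem_univ _⟩, fun x _ y _ => by simpa using hD x y⟩
  · rintro k A (h | h)
    · exact h.1.isClosed
    · exact h.1.sat.isClosed
  · rintro k A (h | h)
    · exact h.2.1
    · exact h.1.nonempty
  · rintro k A (h | h) x hx y hy
    · rw [hlev]
      refine (h.2.2 x hx y hy).trans (mul_le_mul_of_nonneg_right ?_ (hrp _).le)
      exact le_mul_of_one_le_right (by linarith) (hone M)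
    · rw [hlev]
      exact h.2 x hx y hy
  · intro k A hA
    obtain ⟨ℋ, hℋ, hcard, H⟩ : ∃ ℋ, IsPart ℋ A ∧ ℋ.card = Fintype.card ι ^ M ∧ ∀ H ∈ ℋ,
        (S.Sat (M * (k + 1)) H ∧ H.Nonempty ∧
          ∀ x ∈ H, ∀ y ∈ H, dist x y ≤ D * S.r ^ (M * (k + 1))) ∨
        (S.GoodUnion (Fintype.card ι ^ p) M (M * (k + 1) + s) H ∧
          ∀ x ∈ H, ∀ y ∈ H, dist x y ≤ D * (S.r ^ M)⁻¹ * S.r ^ (M * (k + 1))) := by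
      rcases hA with ⟨hsat, hne, hd⟩ | ⟨hgood, -⟩
      · obtain ⟨ℋ, hℋ, hcard, H⟩ := exists_split_of_sat hK hi hs hp hsat hne (hKD _ _ hd)
        refine ⟨ℋ, hℋ, hcard, fun G hG => ?_⟩
        rcases H G hG with ⟨h1, h2⟩ | h
        · refine Or.inl ⟨h1, hℋ.nonempty G hG, fun x hx y hy => ?_⟩
          exact (h2 x hx y hy).trans (le_mul_of_one_le_left (hrp _).le hD1)
        · refine Or.inr ⟨h, fun x hx y hy => ?_⟩
          rw [mul_assoc, hshift]
          exact hd x (hℋ.subset hG hx) y (hℋ.subset hG hy)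
      · obtain ⟨ℋ, hℋ, hcard, H⟩ := hgood.exists_split hK hi' hpM
        refine ⟨ℋ, hℋ, hcard, fun G hG => Or.inr ⟨?_, fun x hx y hy => ?_⟩⟩
        · have := (H G hG).1
          rwa [show M * k + s + M = M * (k + 1) + s by ring] at this
        · rw [mul_assoc, hshift]
          refine ((H G hG).2 x hx y hy).trans ?_
          refine (pow_le_pow_of_le_one S.r_pos.le S.r_lt_one.le (Nat.le_add_right _ s)).trans ?_
          exact le_mul_of_one_le_left (hrp _).le hD1
    have hsat : ∀ G ∈ ℋ, S.Sat (M * (k + 1) + s + M) G := by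
      intro G hG
      rcases H G hG with h | h
      · exact h.1.mono (by omega)
      · exact h.1.sat
    let e := ℋ.equivFinOfCardEq hcard
    refine ⟨fun j => (e.symm j).1, fun j => H _ (e.symm j).2, ?_, ?_⟩
    · rw [← hℋ.sUnion, sUnion_eq_iUnion]
      exact e.symm.surjective.iUnion_comp fun G : ℋ => G.1
    · intro j j' hjj x hx y hy
      have hdisj : Disjoint (e.symm j).1 (e.symm j').1 :=
        hℋ.disj _ (e.symm j).2 _ (e.symm j').2 fun heq =>
          hjj (e.symm.injective (Subtype.ext heq))
      refine ((hsat _ (e.symm j).2).lt_dist hdisj hx hy).le.trans_eq' ?_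
      rw [hlev, mul_assoc S.δ, ← pow_add]
      congr 2
      ring

end FilledSystem

/-- A totally disconnected compact space covered by finitely many similarities with finite
overlap is symbolically coded along an arithmetic progression of scales. -/
theorem SimSystem.exists_symbolicallyCoded {X ι : Type*} [MetricSpace X] [CompactSpace X]
    [TotallyDisconnectedSpace X] [Nonempty X] [Fintype ι] [Nontrivial ι] (S : SimSystem X ι)
    (hS : S.FiniteOverlap) :
    ∃ b i₀ : ℕ, 0 < b ∧
      ∀ i ≥ i₀, SymbolicallyCoded X (Fintype.card ι ^ (b * i)) (S.r ^ (b * i)) := by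
  obtain ⟨δ, hδ, hδ1, hchain⟩ := S.exists_uniformly_disconnected hS
  obtain ⟨D, hD⟩ := Metric.isBounded_iff.1 (isCompact_univ (X := X)).isBounded
  have hD' : ∀ x y : X, dist x y ≤ max D 1 := fun x y =>
    (hD (mem_univ x) (mem_univ y)).trans (le_max_left _ _)
  have hpos : 0 < max D 1 := lt_max_of_lt_right one_pos
  obtain ⟨m, hm⟩ := exists_pow_lt_of_lt_one (div_pos hδ hpos) S.r_lt_one
  let S₁ : DiscSystem X ι :=
    { S with
      δ := δ
      δ_pos := hδ
      δ_le_one := hδ1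
      chain_le := hchain
      m := m
      base := Classical.arbitrary X
      cell_le := fun x y =>
        (mul_le_mul hm.le (hD' x y) dist_nonneg (div_pos hδ hpos).le).trans_eq
          (div_mul_cancel₀ δ hpos.ne')
      overlap := hS }
  obtain ⟨h, J, a, F, hh, ha, hF, hFne, hcnt, hdvd⟩ := S₁.exists_filler
  let S₂ : FilledSystem X ι :=
    { S₁ with
      h := h
      J := J
      a := a
      F := F
      h_pos := hh
      a_pos := ha
      intSat_F := hF
      nonempty_F := hFne
      cnt_F := hcnt
      dvd_cnt := hdvd }
  obtain ⟨i₀, hi₀⟩ := S₂.exists_symbolicallyCoded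
  exact ⟨S₂.b, i₀, Nat.add_pos_right _ S₂.a_pos, hi₀⟩

section Euclidean

variable {d : ℕ}

/-- A similarity of a Euclidean space is surjective. -/
theorem surjective_of_dist_eq_mul {f : EuclideanSpace ℝ (Fin d) → EuclideanSpace ℝ (Fin d)}
    {r : ℝ} (hr : 0 < r) (hf : ∀ x y, dist (f x) (f y) = r * dist x y) :
    Function.Surjective f := by
  have hi : Isometry fun x => r⁻¹ • f x := Isometry.of_dist_eq fun x y => by
    rw [dist_smul₀, hf, norm_inv, Real.norm_of_nonneg hr.le, inv_mul_cancel_left₀ hr.ne']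
  intro y
  obtain ⟨x, hx⟩ :=
    (hi.affineIsometryOfStrictConvexSpace.toAffineIsometryEquiv rfl).surjective (r⁻¹ • y)
  refine ⟨x, smul_right_injective _ (inv_ne_zero hr.ne') ?_⟩
  simpa using hx

namespace IFS

variable (S : IFS d)

/-- An iterated function system has an attractor. -/
theorem exists_isAttractor [Nonempty S.ι] : ∃ E, S.IsAttractor E := by
  classical
  obtain ⟨i₁, -, hi₁⟩ := Finset.exists_max_image Finset.univ S.r Finset.univ_nonempty
  have hc : ∀ i, Continuous (S.f i) := fun i =>
    (LipschitzWith.of_dist_le_mul (K := ⟨S.r i, (S.r_pos i).le⟩) fun x y =>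
      (S.sim i x y).le).continuous
  set ρ := S.r i₁
  have hρ : ρ < 1 := S.r_lt_one i₁
  let p : EuclideanSpace ℝ (Fin d) := 0
  obtain ⟨i₂, -, hi₂⟩ :=
    Finset.exists_max_image Finset.univ (fun i => dist (S.f i p) p) Finset.univ_nonempty
  set R := dist (S.f i₂ p) p / (1 - ρ) with hR
  have hball : ∀ i, ∀ x ∈ closedBall p R, S.f i x ∈ closedBall p R := by
    intro i x hx
    rw [mem_closedBall] at hx ⊢
    have h1 := dist_triangle (S.f i x) (S.f i p) p
    rw [S.sim] at h1
    have h2 := hi₂ i (Finset.mem_univ i)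
    have h3 : S.r i * dist x p ≤ ρ * R :=
      mul_le_mul (hi₁ i (Finset.mem_univ i)) hx dist_nonneg (S.r_pos i₁).le
    have h4 : R * (1 - ρ) = dist (S.f i₂ p) p := div_mul_cancel₀ _ (by linarith)
    linarith
  have hR0 : 0 ≤ R := div_nonneg dist_nonneg (by linarith)
  let Φ : Set (EuclideanSpace ℝ (Fin d)) → Set (EuclideanSpace ℝ (Fin d)) :=
    fun A => ⋃ i, S.f i '' A
  let K : ℕ → Set (EuclideanSpace ℝ (Fin d)) := fun n => Φ^[n] (closedBall p R)
  have hmono : Monotone Φ := fun A B h => iUnion_mono fun i => image_mono h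
  have hKs : ∀ n, K (n + 1) = Φ (K n) := fun n => Function.iterate_succ_apply' _ _ _
  have hK1 : ∀ n, K (n + 1) ⊆ K n := by
    intro n
    induction n with
    | zero =>
      refine iUnion_subset fun i => ?_
      rintro _ ⟨x, hx, rfl⟩
      exact hball i x hx
    | succ n ih =>
      rw [hKs (n + 1)]
      exact (hmono ih).trans_eq (hKs n).symm
  have hKc : ∀ n, IsCompact (K n) := by
    intro n
    induction n with
    | zero => exact isCompact_closedBall p R
    | succ n ih => rw [hKs]; exact isCompact_iUnion fun i => ih.image (hc i)
  have hKn : ∀ n, (K n).Nonempty := by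
    intro n
    induction n with
    | zero => exact ⟨p, mem_closedBall_self hR0⟩
    | succ n ih =>
      rw [hKs]
      obtain ⟨x, hx⟩ := ih
      exact ⟨S.f i₁ x, mem_iUnion.2 ⟨i₁, x, hx, rfl⟩⟩
  have hanti : Antitone K := antitone_nat_of_succ_le hK1
  refine ⟨⋂ n, K n, IsCompact.nonempty_iInter_of_sequence_nonempty_isCompact_isClosed K hK1 hKn
    (hKc 0) fun n => (hKc n).isClosed,
    (hKc 0).of_isClosed_subset (isClosed_iInter fun n => (hKc n).isClosed) (iInter_subset K 0), ?_⟩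
  refine Subset.antisymm ?_ (iUnion_subset fun i => ?_)
  · intro x hx
    have hx' : ∀ n, ∃ i, x ∈ S.f i '' K n := fun n => by
      have := mem_iInter.1 hx (n + 1)
      rw [hKs] at this
      exact mem_iUnion.1 this
    choose g hg using hx'
    obtain ⟨i, hi⟩ := Finite.exists_infinite_fiber g
    rw [infinite_coe_iff] at hi
    have hinj : Function.Injective (S.f i) := fun y z h => by
      have h1 := S.sim i y z
      rw [h, dist_self] at h1
      exact dist_eq_zero.1 ((mul_eq_zero.1 h1.symm).resolve_left (S.r_pos i).ne')
    obtain ⟨n₀, hn₀⟩ := hi.nonempty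
    obtain ⟨y, -, hy⟩ := hn₀ ▸ hg n₀
    refine mem_iUnion.2 ⟨i, y, mem_iInter.2 fun n => ?_, hy⟩
    obtain ⟨k, hk, hnk⟩ := hi.exists_gt n
    obtain ⟨z, hz, hzx⟩ := hk ▸ hg k
    rw [hinj (hy.trans hzx.symm)]
    exact hanti hnk.le hz
  · rintro _ ⟨y, hy, rfl⟩
    refine mem_iInter.2 fun n => hK1 n ?_
    rw [hKs]
    exact mem_iUnion.2 ⟨i, y, mem_iInter.1 hy n, rfl⟩

theorem isAttractor_attractor [Nonempty S.ι] : S.IsAttractor S.attractor := by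
  rw [attractor, dif_pos S.exists_isAttractor]
  exact S.exists_isAttractor.choose_spec

theorem attractor_eq_empty [IsEmpty S.ι] : S.attractor = ∅ := by
  refine dif_neg ?_
  rintro ⟨E, hne, -, hE⟩
  rw [iUnion_of_empty] at hE
  exact hne.ne_empty hE

/-- The attractor of a single similarity is a point. -/
theorem subsingleton_attractor [Subsingleton S.ι] [Nonempty S.ι] : S.attractor.Subsingleton := by
  obtain ⟨-, hc, hE⟩ := S.isAttractor_attractor
  obtain ⟨i⟩ := ‹Nonempty S.ι›
  have hbdd := hc.isBounded
  have hle : diam S.attractor ≤ S.r i * diam S.attractor := by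
    refine diam_le_of_forall_dist_le (mul_nonneg (S.r_pos i).le diam_nonneg) ?_
    intro x hx y hy
    rw [hE] at hx hy
    obtain ⟨j, x', hx', rfl⟩ := mem_iUnion.1 hx
    obtain ⟨k, y', hy', rfl⟩ := mem_iUnion.1 hy
    rw [Subsingleton.elim j i, Subsingleton.elim k i, S.sim]
    exact mul_le_mul_of_nonneg_left (dist_le_diam_of_mem hbdd hx' hy') (S.r_pos i).le
  have h1 := S.r_lt_one i
  have h0 : diam S.attractor ≤ 0 := by nlinarith [diam_nonneg (s := S.attractor)]
  intro x hx y hy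
  exact dist_le_zero.1 ((dist_le_diam_of_mem hbdd hx hy).trans h0)

variable {S} {r : ℝ}

/-- The whole space with the maps of an iterated function system of common ratio. -/
def ambientSystem [Nonempty S.ι] (hr0 : 0 < r) (hr1 : r < 1) (hS : ∀ i, S.r i = r) :
    SimSystem (EuclideanSpace ℝ (Fin d)) S.ι where
  φ := S.f
  r := r
  r_pos := hr0
  r_lt_one := hr1
  sim i x y := by rw [S.sim, hS]
  cover x := ⟨Classical.arbitrary S.ι, surjective_of_dist_eq_mul (S.r_pos _) (S.sim _) x⟩

/-- The attractor with the maps of an iterated function system of common ratio. -/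
def attractorSystem [Nonempty S.ι] (hr0 : 0 < r) (hr1 : r < 1) (hS : ∀ i, S.r i = r) :
    SimSystem S.attractor S.ι where
  φ i x := ⟨S.f i x, S.isAttractor_attractor.2.2.ge (mem_iUnion.2 ⟨i, x, x.2, rfl⟩)⟩
  r := r
  r_pos := hr0
  r_lt_one := hr1
  sim i x y := by rw [Subtype.dist_eq, Subtype.dist_eq, S.sim, hS]
  cover x := by
    obtain ⟨i, y, hy, hyx⟩ := mem_iUnion.1 (S.isAttractor_attractor.2.2.le x.2)
    exact ⟨i, ⟨y, hy⟩, Subtype.ext hyx⟩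

variable [Nonempty S.ι] (hr0 : 0 < r) (hr1 : r < 1) (hS : ∀ i, S.r i = r)

theorem coe_word_attractorSystem (w : List S.ι) (x : S.attractor) :
    ((attractorSystem hr0 hr1 hS).word w x : EuclideanSpace ℝ (Fin d)) =
      (ambientSystem hr0 hr1 hS).word w x := by
  induction w with
  | nil => rfl
  | cons i w ih =>
    change S.f i ((attractorSystem hr0 hr1 hS).word w x) =
      S.f i ((ambientSystem hr0 hr1 hS).word w x)
    rw [ih]

theorem word_image_subset {O : Set (EuclideanSpace ℝ (Fin d))} (hO : S.OSCSet O)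
    (w : List S.ι) : (ambientSystem hr0 hr1 hS).word w '' O ⊆ O := by
  induction w with
  | nil => simp [SimSystem.word]
  | cons i w ih =>
    rw [SimSystem.word, image_comp]
    exact (image_mono ih).trans (hO.2.2.2.1 i)

theorem disjoint_word_image {O : Set (EuclideanSpace ℝ (Fin d))} (hO : S.OSCSet O)
    {w w' : List S.ι} (hl : w.length = w'.length) (hne : w ≠ w') :
    Disjoint ((ambientSystem hr0 hr1 hS).word w '' O)
      ((ambientSystem hr0 hr1 hS).word w' '' O) := by
  induction w generalizing w' with
  | nil => exact absurd (List.length_eq_zero_iff.1 hl.symm).symm hne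
  | cons i w ih =>
    cases w' with
    | nil => simp at hl
    | cons j w' =>
      rw [SimSystem.word, SimSystem.word, image_comp, image_comp]
      by_cases hij : i = j
      · subst hij
        exact (disjoint_image_iff ((ambientSystem hr0 hr1 hS).word_injective [i])).2
          (ih (by simpa using hl) (by simpa using hne))
      · exact (hO.2.2.2.2 i j hij).mono (image_mono (word_image_subset hr0 hr1 hS hO w))
          (image_mono (word_image_subset hr0 hr1 hS hO w'))

/-- Under the open set condition the cells of the attractor have finite overlap. -/
theorem finiteOverlap_attractorSystem (hosc : S.OSC) :
    (attractorSystem hr0 hr1 hS).FiniteOverlap := by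
  classical
  obtain ⟨O, hO⟩ := hosc
  obtain ⟨a, ha⟩ := hO.1
  obtain ⟨ε, hε, hball⟩ := Metric.isOpen_iff.1 hO.2.1 a ha
  set T := ambientSystem hr0 hr1 hS with hT
  have hTr : T.r = r := rfl
  have hsep : ∀ w w' : List S.ι, w.length = w'.length → w ≠ w' →
      ε * r ^ w.length ≤ dist (T.word w a) (T.word w' a) := by
    intro w w' hl hne
    by_contra! hlt
    have hsurj : Function.Surjective (T.word w) := surjective_of_dist_eq_mul
      (pow_pos T.r_pos w.length) (T.dist_word w)
    obtain ⟨z, hz⟩ := hsurj (T.word w' a)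
    have hp := pow_pos hr0 w.length
    have hza : z ∈ O := hball (by
      rw [← hz, T.dist_word, hTr, mul_comm ε] at hlt
      rw [mem_ball, dist_comm]
      exact lt_of_mul_lt_mul_left hlt hp.le)
    exact (disjoint_left.1 (disjoint_word_image hr0 hr1 hS hO hl hne))
      ⟨z, hza, hz⟩ ⟨a, ha, rfl⟩
  obtain ⟨R, hR⟩ := (isBounded_iff_subset_closedBall a).1 S.isAttractor_attractor.2.1.isBounded
  intro C
  obtain ⟨t, -, htf, ht⟩ := finite_cover_balls_of_compact
    (isCompact_closedBall (0 : EuclideanSpace ℝ (Fin d)) (C + R)) (half_pos hε)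
  refine ⟨t.ncard, fun n x => ?_⟩
  have hp : 0 < r ^ n := pow_pos hr0 n
  have hz : ∀ w ∈ {w : List S.ι | w.length = n ∧ ∃ y,
      dist x ((attractorSystem hr0 hr1 hS).word w y) ≤ C * (attractorSystem hr0 hr1 hS).r ^ n},
      ∃ c ∈ t, dist ((r ^ n)⁻¹ • (T.word w a - x)) c < ε / 2 := by
    rintro w ⟨hw, y, hy⟩
    have hy' : dist (x : EuclideanSpace ℝ (Fin d)) (T.word w y) ≤ C * r ^ n := by
      rw [← coe_word_attractorSystem]
      exact hy
    have hya : dist (y : EuclideanSpace ℝ (Fin d)) a ≤ R := hR y.2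
    have h1 := dist_triangle (x : EuclideanSpace ℝ (Fin d)) (T.word w y) (T.word w a)
    rw [T.dist_word, hTr, hw] at h1
    have h2 := mul_le_mul_of_nonneg_left hya hp.le
    have hmem : (r ^ n)⁻¹ • (T.word w a - x) ∈
        closedBall (0 : EuclideanSpace ℝ (Fin d)) (C + R) := by
      rw [mem_closedBall_zero_iff, norm_smul, norm_inv, Real.norm_of_nonneg hp.le,
        ← dist_eq_norm, dist_comm, inv_mul_le_iff₀ hp]
      linarith
    obtain ⟨c, hc, hc'⟩ := mem_iUnion₂.1 (ht hmem)
    exact ⟨c, hc, hc'⟩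
  choose! g hg hgd using hz
  refine ncard_le_ncard_of_injOn g hg ?_ htf
  intro w hw w' hw' hgg
  by_contra hne
  have h1 := hsep w w' (hw.1.trans hw'.1.symm) hne
  have h2 := hgd w hw
  have h3 := hgd w' hw'
  rw [hw.1] at h1
  rw [← hgg] at h3
  have h4 := (dist_triangle_right _ _ _).trans_lt (add_lt_add h2 h3)
  rw [dist_smul₀, dist_sub_right, norm_inv, Real.norm_of_nonneg hp.le, add_halves,
    inv_mul_lt_iff₀ hp] at h4
  linarith

theorem exists_symbolicallyCoded_attractor {S : IFS d} {r : ℝ} [Nontrivial S.ι] (hr0 : 0 < r)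
    (hr1 : r < 1) (hS : ∀ i, S.r i = r) (hosc : S.OSC) (htd : IsTotallyDisconnected S.attractor) :
    ∃ b i₀ : ℕ, 0 < b ∧
      ∀ i ≥ i₀, SymbolicallyCoded S.attractor (Nat.card S.ι ^ (b * i)) (r ^ (b * i)) := by
  have hE := S.isAttractor_attractor
  have : CompactSpace S.attractor := isCompact_iff_compactSpace.1 hE.2.1
  have : Nonempty S.attractor := hE.1.to_subtype
  have : TotallyDisconnectedSpace S.attractor := totallyDisconnectedSpace_subtype_iff.2 htd
  rw [Nat.card_eq_fintype_card]
  exact (attractorSystem hr0 hr1 hS).exists_symbolicallyCoded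
    (finiteOverlap_attractorSystem hr0 hr1 hS hosc)

end IFS

end Euclidean

theorem LipEquiv.of_equiv {X Y : Type*} [MetricSpace X] [MetricSpace Y] [Nonempty Y] {A : Set X}
    {B : Set Y} (e : A ≃ B) {L : ℝ} (hL : 1 ≤ L)
    (he : ∀ x y, L⁻¹ * dist x y ≤ dist (e x) (e y) ∧ dist (e x) (e y) ≤ L * dist x y) :
    LipEquiv A B := by
  classical
  let f : X → Y := fun x => if h : x ∈ A then e ⟨x, h⟩ else Classical.arbitrary Y
  have hf : ∀ x (h : x ∈ A), f x = e ⟨x, h⟩ := fun x h => dif_pos h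
  refine ⟨f, L, hL, ⟨?_, ?_, ?_⟩, ?_⟩
  · intro x hx
    rw [hf x hx]
    exact (e ⟨x, hx⟩).2
  · intro x hx y hy hxy
    rw [hf x hx, hf y hy] at hxy
    exact congrArg Subtype.val (e.injective (Subtype.ext hxy))
  · intro y hy
    refine ⟨e.symm ⟨y, hy⟩, (e.symm ⟨y, hy⟩).2, ?_⟩
    rw [hf _ (e.symm ⟨y, hy⟩).2]
    simp
  · intro x hx y hy
    rw [hf x hx, hf y hy]
    exact he ⟨x, hx⟩ ⟨y, hy⟩

theorem LipEquiv.of_subsingleton {X Y : Type*} [MetricSpace X] [MetricSpace Y] {A : Set X}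
    {B : Set Y} (hA : A.Subsingleton) (hB : B.Subsingleton) (hA' : A.Nonempty)
    (hB' : B.Nonempty) : LipEquiv A B := by
  obtain ⟨b, hb⟩ := hB'
  refine ⟨fun _ => b, 1, le_rfl, ⟨fun _ _ => hb, fun x hx y hy _ => hA hx hy, fun y hy => ?_⟩, ?_⟩
  · obtain ⟨a, ha⟩ := hA'
    exact ⟨a, ha, hB hb hy⟩
  · intro x hx y hy
    simp [hA hx hy]

/-- **Theorem.** Totally disconnected self-similar sets `E ⊆ ℝ^d` and `E' ⊆ ℝ^{d'}`,
each satisfying the OSC and each generated by exactly `N` contracting similarities all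
of the same ratio `r ∈ (0,1)`, are Lipschitz equivalent. -/
theorem lipEquiv_of_card_eq_of_ratio_eq {d d' N : ℕ} (r : ℝ) (hr0 : 0 < r) (hr1 : r < 1)
    (S : IFS d) (T : IFS d') (hSN : Nat.card S.ι = N) (hTN : Nat.card T.ι = N)
    (hSr : ∀ i, S.r i = r) (hTr : ∀ i, T.r i = r)
    (hSosc : S.OSC) (hTosc : T.OSC)
    (hStd : IsTotallyDisconnected S.attractor)
    (hTtd : IsTotallyDisconnected T.attractor) :
    LipEquiv S.attractor T.attractor := by
  rcases Nat.lt_trichotomy N 1 with hN | hN | hN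
  · obtain rfl : N = 0 := by omega
    have : IsEmpty S.ι := Finite.card_eq_zero_iff.1 hSN
    have : IsEmpty T.ι := Finite.card_eq_zero_iff.1 hTN
    rw [S.attractor_eq_empty, T.attractor_eq_empty]
    exact ⟨fun _ => 0, 1, le_rfl, bijOn_empty _, fun x hx => absurd hx (notMem_empty x)⟩
  · subst hN
    obtain ⟨_, _⟩ := Nat.card_eq_one_iff_unique.1 hSN
    obtain ⟨_, _⟩ := Nat.card_eq_one_iff_unique.1 hTN
    exact LipEquiv.of_subsingleton S.subsingleton_attractor T.subsingleton_attractor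
      S.isAttractor_attractor.1 T.isAttractor_attractor.1
  · have : Nontrivial S.ι := Finite.one_lt_card_iff_nontrivial.1 (hSN ▸ hN)
    have : Nontrivial T.ι := Finite.one_lt_card_iff_nontrivial.1 (hTN ▸ hN)
    obtain ⟨b, i, hb, hSc⟩ := IFS.exists_symbolicallyCoded_attractor hr0 hr1 hSr hSosc hStd
    obtain ⟨b', i', hb', hTc⟩ := IFS.exists_symbolicallyCoded_attractor hr0 hr1 hTr hTosc hTtd
    rw [hSN] at hSc
    rw [hTN] at hTc
    have h1 := hSc (b' * (i + i')) ((Nat.le_add_right i i').trans (Nat.le_mul_of_pos_left _ hb'))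
    have h2 := hTc (b * (i + i')) ((Nat.le_add_left i' i).trans (Nat.le_mul_of_pos_left _ hb))
    rw [mul_left_comm] at h2
    obtain ⟨e, L, hL, he⟩ := SymbolicallyCoded.exists_equiv (pow_pos hr0 _) h1 h2
    exact LipEquiv.of_equiv e hL he

end
end

section
/- Let p ∈ (0,1) and suppose there exist positive integers λ_1, ..., λ_N (repetitions allowed) with gcd(λ_1, ..., λ_N) = 1 such that p^{λ_1} + p^{λ_2} + ... + p^{λ_N} = 1. Then for every nonzero ideal I of the ring Z[p] there exists a positive integer ℓ such that 1 − p^ℓ ∈ I. -/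
noncomputable section

/-- If `∑ i, p ^ lam i = 1` then `p⁻¹` is an algebraic integer. -/
theorem isIntegral_inv_of_sum_pow_eq_one {p : ℝ} (hp : p ≠ 0) {N : ℕ} {lam : Fin N → ℕ}
    (hpos : ∀ i, 0 < lam i) (hsum : ∑ i, p ^ lam i = 1) : IsIntegral ℤ p⁻¹ := by
  set M := ∑ i, lam i
  have hle : ∀ i, lam i ≤ M := fun i =>
    Finset.single_le_sum (fun _ _ => Nat.zero_le _) (Finset.mem_univ i)
  refine ⟨Polynomial.X ^ M - ∑ i, Polynomial.X ^ (M - lam i), ?_, ?_⟩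
  · apply Polynomial.monic_X_pow_sub
    refine (Polynomial.degree_sum_le _ _).trans_lt ?_
    refine (Finset.sup_lt_iff (WithBot.bot_lt_coe M)).2 fun i _ => ?_
    rw [Polynomial.degree_X_pow]
    have := hpos i
    have := hle i
    exact WithBot.coe_lt_coe.2 (by omega : M - lam i < M)
  · have key : ∀ i, p⁻¹ ^ (M - lam i) = p⁻¹ ^ M * p ^ lam i := fun i => by
      rw [pow_sub₀ _ (inv_ne_zero hp) (hle i), inv_pow p (lam i), inv_inv]
    simp only [Polynomial.eval₂_sub, Polynomial.eval₂_finsetSum, Polynomial.eval₂_pow,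
      Polynomial.eval₂_X, key]
    rw [← Finset.mul_sum, hsum, mul_one, sub_self]

theorem self_mem_Zring (p : ℝ) : p ∈ Zring p :=
  Subring.subset_closure rfl

/-- If `∑ i, p ^ lam i = 1` then `p` is invertible in `ℤ[p]`. -/
theorem inv_mem_Zring_of_sum_pow_eq_one {p : ℝ} {N : ℕ} {lam : Fin N → ℕ}
    (hpos : ∀ i, 0 < lam i) (hsum : ∑ i, p ^ lam i = 1) : p⁻¹ ∈ Zring p := by
  have h : p⁻¹ = ∑ i, p ^ (lam i - 1) := by
    refine (eq_inv_of_mul_eq_one_left ?_).symm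
    rw [← hsum, Finset.sum_mul]
    exact Finset.sum_congr rfl fun i _ => pow_sub_one_mul (hpos i).ne' p
  rw [h]
  exact sum_mem fun i _ => pow_mem (self_mem_Zring p) _

/-- Every element of `ℤ[p]` is carried into `ℤ[p⁻¹]` by some power of `p⁻¹`. -/
theorem exists_inv_pow_mul_mem_adjoin {p : ℝ} (hp : p ≠ 0) {x : ℝ} (hx : x ∈ Zring p) :
    ∃ k : ℕ, p⁻¹ ^ k * x ∈ Algebra.adjoin ℤ {p⁻¹} := by
  have hb : ∀ k : ℕ, p⁻¹ ^ k ∈ Algebra.adjoin ℤ {p⁻¹} := fun k =>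
    pow_mem (Algebra.self_mem_adjoin_singleton ℤ p⁻¹) k
  induction hx using Subring.closure_induction with
  | mem x hx =>
    obtain rfl : x = p := hx
    exact ⟨1, by simp [hp]⟩
  | zero => exact ⟨0, by simp⟩
  | one => exact ⟨0, by simp⟩
  | add x y _ _ ihx ihy =>
    obtain ⟨k, hk⟩ := ihx
    obtain ⟨l, hl⟩ := ihy
    refine ⟨k + l, ?_⟩
    convert add_mem (mul_mem (hb l) hk) (mul_mem (hb k) hl) using 1
    ring
  | neg x _ ih =>
    obtain ⟨k, hk⟩ := ih
    exact ⟨k, by simpa using hk⟩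
  | mul x y _ _ ihx ihy =>
    obtain ⟨k, hk⟩ := ihx
    obtain ⟨l, hl⟩ := ihy
    refine ⟨k + l, ?_⟩
    convert mul_mem hk hl using 1
    ring

/-- **Lemma.** Let `p ∈ (0,1)` with `p^{λ_1} + ⋯ + p^{λ_N} = 1` for positive integers
`λ_i` with `gcd(λ_1, …, λ_N) = 1`. Then every nonzero ideal `I` of `ℤ[p]` contains
`1 - p^ℓ` for some positive integer `ℓ`. -/
theorem exists_one_sub_pow_mem_of_ne_bot (p : ℝ) (hp0 : 0 < p) (hp1 : p < 1)
    (N : ℕ) (hN : 0 < N) (lam : Fin N → ℕ) (hpos : ∀ i, 0 < lam i)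
    (hgcd : Finset.univ.gcd lam = 1) (hsum : ∑ i, p ^ lam i = 1)
    (I : Ideal (Zring p)) (hI : I ≠ ⊥) :
    ∃ ℓ : ℕ, 0 < ℓ ∧ ∃ x : Zring p, x ∈ I ∧ (x : ℝ) = 1 - p ^ ℓ := by
  have hp : p ≠ 0 := hp0.ne'
  have hinv : p⁻¹ ∈ Zring p := inv_mem_Zring_of_sum_pow_eq_one hpos hsum
  set A := Algebra.adjoin ℤ {p⁻¹}
  have hAR : A.toSubring ≤ Zring p := by
    have h : A ≤ subalgebraOfSubring (Zring p) :=
      Algebra.adjoin_le (Set.singleton_subset_iff.2 hinv)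
    exact h
  have : Module.Finite ℤ A := Module.Finite.iff_fg.2
    (isIntegral_inv_of_sum_pow_eq_one hp hpos hsum).fg_adjoin_singleton
  have : Module.Free ℤ A := Module.free_of_finite_type_torsion_free'
  let f : A →+* Zring p := Subring.inclusion hAR
  have hJ : I.comap f ≠ ⊥ := by
    obtain ⟨x, hxI, hx0⟩ := Submodule.exists_mem_ne_zero_of_ne_bot hI
    obtain ⟨k, hk⟩ := exists_inv_pow_mul_mem_adjoin hp x.2
    refine Submodule.ne_bot_iff _ |>.2 ⟨⟨_, hk⟩, ?_, fun h => ?_⟩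
    · exact I.mul_mem_left (⟨p⁻¹, hinv⟩ ^ k) hxI
    · have h' : p⁻¹ ^ k * (x : ℝ) = 0 := congrArg Subtype.val h
      exact hx0 (Subtype.ext ((mul_eq_zero.1 h').resolve_left (pow_ne_zero _ (inv_ne_zero hp))))
  have : Finite (A ⧸ I.comap f) := Ideal.finiteQuotientOfFreeOfNeBot _ hJ
  let b : A := ⟨p⁻¹, Algebra.self_mem_adjoin_singleton ℤ p⁻¹⟩
  obtain ⟨i, j, hij, h⟩ : ∃ i j : ℕ, i < j ∧
      Ideal.Quotient.mk (I.comap f) (b ^ j) = Ideal.Quotient.mk (I.comap f) (b ^ i) := by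
    obtain ⟨i, j, hne, h⟩ := Finite.exists_ne_map_eq_of_infinite
      fun n : ℕ => Ideal.Quotient.mk (I.comap f) (b ^ n)
    rcases hne.lt_or_gt with hlt | hlt
    · exact ⟨i, j, hlt, h.symm⟩
    · exact ⟨j, i, hlt, h⟩
  have hmem : f (b ^ j - b ^ i) ∈ I := Ideal.Quotient.eq.1 h
  refine ⟨j - i, Nat.sub_pos_of_lt hij, _,
    I.mul_mem_left (⟨p, self_mem_Zring p⟩ ^ j) hmem, ?_⟩
  change p ^ j * (p⁻¹ ^ j - p⁻¹ ^ i) = 1 - p ^ (j - i)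
  rw [mul_sub, ← mul_pow, mul_inv_cancel₀ hp, one_pow, pow_sub₀ p hp hij.le, inv_pow]

end
end
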